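/- Let G be a finite non-cyclic group and let p be the smallest prime divisor of |G|. Then D(G) ≤ (2/p)·|G|. -/

import Mathlib

/-- The set of all products of the terms of the multiset `S` taken in some order. -/
def prodSet {G : Type*} [Group G] (S : Multiset G) : Set G :=
  {g | ∃ l : List G, (l : Multiset G) = S ∧ l.prod = g}

/-- A sequence (multiset) over `G` is a product-one sequence if its terms can be
ordered so that their product is `1`. -/
def IsProductOne {G : Type*} [Group G] (S : Multiset G) : Prop :=
  (1 : G) ∈ prodSet S

/-- A minimal product-one sequence (atom): a nontrivial product-one sequence that cannot
be partitioned into two nontrivial product-one subsequences. -/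
def IsMinimalProductOne {G : Type*} [Group G] (S : Multiset G) : Prop :=
  S ≠ 0 ∧ IsProductOne S ∧
    ¬ ∃ T₁ T₂ : Multiset G, T₁ ≠ 0 ∧ T₂ ≠ 0 ∧ S = T₁ + T₂ ∧
      IsProductOne T₁ ∧ IsProductOne T₂

/-- The small Davenport constant: the maximal length of a sequence over `G` having
no nontrivial product-one subsequence. -/
noncomputable def smallDavenport (G : Type*) [Group G] : ℕ :=
  sSup {n | ∃ S : Multiset G, Multiset.card S = n ∧
    ∀ T : Multiset G, T ≤ S → T ≠ 0 → ¬ IsProductOne T}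

/-- The large Davenport constant: the maximal length of a minimal product-one sequence. -/
noncomputable def largeDavenport (G : Type*) [Group G] : ℕ :=
  sSup {n | ∃ S : Multiset G, Multiset.card S = n ∧ IsMinimalProductOne S}

/-- Every minimal product-one sequence over `G` has at most `B` terms. -/
def AtomBound (G : Type*) [Group G] (B : ℕ) : Prop :=
  ∀ S : Multiset G, IsMinimalProductOne S → S.card ≤ B

theorem largeDavenport_le {G : Type*} [Group G] {B : ℕ} (h : AtomBound G B) :
    largeDavenport G ≤ B := by
  apply csSup_le'
  rintro n ⟨S, rfl, hS⟩
  exact h S hS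

theorem exists_list_of_coe_eq_map {α β : Type*} (f : α → β) (l : List β) (M : Multiset α)
    (h : (l : Multiset β) = M.map f) : ∃ L : List α, (L : Multiset α) = M ∧ L.map f = l := by
  classical
  induction l generalizing M with
  | nil => exact ⟨[], by simpa [eq_comm] using h, rfl⟩
  | cons b l ih =>
    have hb : b ∈ M.map f := h ▸ by simp
    obtain ⟨a, ha, rfl⟩ := Multiset.mem_map.1 hb
    obtain ⟨M', rfl⟩ := Multiset.exists_cons_of_mem ha
    obtain ⟨L, rfl, rfl⟩ := ih M' (by
      rw [Multiset.map_cons, ← Multiset.cons_coe] at h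
      exact (Multiset.cons_inj_right _).1 h)
    exact ⟨a :: L, rfl, rfl⟩

theorem exists_add_of_map_eq_add {α β : Type*} (f : α → β) (M : Multiset α)
    (T₁ T₂ : Multiset β) (h : M.map f = T₁ + T₂) :
    ∃ M₁ M₂, M = M₁ + M₂ ∧ M₁.map f = T₁ ∧ M₂.map f = T₂ := by
  obtain ⟨l₁, rfl⟩ := Quot.exists_rep T₁
  obtain ⟨l₂, rfl⟩ := Quot.exists_rep T₂
  obtain ⟨L, rfl, hL⟩ := exists_list_of_coe_eq_map f (l₁ ++ l₂) M (by simpa using h.symm)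
  obtain ⟨L₁, L₂, rfl, rfl, rfl⟩ := List.map_eq_append_iff.1 hL
  exact ⟨L₁, L₂, by simp, by simp, by simp⟩

section
variable {G : Type*} [Group G]

theorem isProductOne_coe {l : List G} (h : l.prod = 1) : IsProductOne (l : Multiset G) :=
  ⟨l, rfl, h⟩

theorem IsProductOne.add {S T : Multiset G} (hS : IsProductOne S) (hT : IsProductOne T) :
    IsProductOne (S + T) := by
  obtain ⟨l, rfl, hl⟩ := hS
  obtain ⟨l', rfl, hl'⟩ := hT
  exact ⟨l ++ l', by simp, by simp [hl, hl']⟩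

theorem IsProductOne.map {H : Type*} [Group H] (f : G →* H) {S : Multiset G}
    (hS : IsProductOne S) : IsProductOne (S.map f) := by
  obtain ⟨l, rfl, hl⟩ := hS
  exact ⟨l.map f, by simp, by rw [← map_list_prod, hl, map_one]⟩

theorem IsProductOne.of_map {H : Type*} [Group H] {f : G →* H} (hf : Function.Injective f)
    {S : Multiset G} (hS : IsProductOne (S.map f)) : IsProductOne S := by
  obtain ⟨l, hl, hl1⟩ := hS
  obtain ⟨L, rfl, rfl⟩ := exists_list_of_coe_eq_map f l S hl
  exact isProductOne_coe (hf (by rw [map_list_prod, hl1, map_one]))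

theorem IsProductOne.sum_of_map_prod {M : Multiset (List G)}
    (h : IsProductOne (M.map List.prod)) :
    IsProductOne (M.map (fun l : List G => (l : Multiset G))).sum := by
  obtain ⟨l, hl, hl1⟩ := h
  obtain ⟨L, rfl, rfl⟩ := exists_list_of_coe_eq_map _ l M hl
  refine ⟨L.flatten, ?_, by rw [List.prod_flatten, hl1]⟩
  clear hl hl1
  induction L with
  | nil => rfl
  | cons a L ih => simp_all [← Multiset.coe_add]

theorem IsMinimalProductOne.eq_zero_or_eq_zero {S T₁ T₂ : Multiset G}
    (h : IsMinimalProductOne S) (hS : S = T₁ + T₂) (h₁ : IsProductOne T₁)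
    (h₂ : IsProductOne T₂) : T₁ = 0 ∨ T₂ = 0 := by
  by_contra! hne
  exact h.2.2 ⟨T₁, T₂, hne.1, hne.2, hS, h₁, h₂⟩

theorem prod_append_comm_eq_one {a b : List G} (h : (a ++ b).prod = 1) : (b ++ a).prod = 1 := by
  rw [List.prod_append] at h ⊢
  exact mul_eq_one_comm.1 h

theorem IsMinimalProductOne.take_prod_ne {l : List G} (h : IsMinimalProductOne (l : Multiset G))
    (hl : l.prod = 1) {i j : ℕ} (hij : i < j) (hj : j < l.length) :
    (l.take i).prod ≠ (l.take j).prod := by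
  intro he
  have hl' : l = l.take i ++ (l.take j).drop i ++ l.drop j := by
    conv_lhs => rw [← List.take_append_drop j l, ← List.take_append_drop i (l.take j)]
    rw [List.take_take, min_eq_left hij.le]
  have hb : ((l.take j).drop i).prod = 1 := by
    have := congrArg List.prod (List.take_append_drop i (l.take j))
    rw [List.take_take, min_eq_left hij.le, List.prod_append, he] at this
    simpa using this
  have hac : (l.take i ++ l.drop j).prod = 1 := by
    rw [hl'] at hl
    simpa [hb] using hl
  have hS : (l : Multiset G) = ((l.take j).drop i : List G) + (l.take i ++ l.drop j : List G) := by
    conv_lhs => rw [hl']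
    simp only [← Multiset.coe_add]
    abel
  rcases h.eq_zero_or_eq_zero hS (isProductOne_coe hb) (isProductOne_coe hac) with h | h
  · rw [Multiset.coe_eq_zero] at h
    have := congrArg List.length h
    simp at this
    omega
  · rw [Multiset.coe_eq_zero] at h
    have := congrArg List.length h
    simp at this
    omega

theorem atomBound_card (G : Type*) [Group G] [Finite G] : AtomBound G (Nat.card G) := by
  classical
  intro S hS
  obtain ⟨l, rfl, hl⟩ := id hS.2.1
  have := Fintype.ofFinite G
  rw [Nat.card_eq_fintype_card, Multiset.coe_card, ← Finset.card_range l.length]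
  refine Finset.card_le_card_of_injOn (fun i => (l.take i).prod) (fun _ _ => Finset.mem_univ _) ?_
  intro i hi j hj hij
  simp only [Finset.coe_range, Set.mem_Iio] at hi hj
  rcases lt_trichotomy i j with h | h | h
  · exact (hS.take_prod_ne hl h hj hij).elim
  · exact h
  · exact (hS.take_prod_ne hl h hi hij.symm).elim

/-- If a minimal product-one sequence is cut into blocks whose products lie in a subgroup and
form a product-one sequence there, the number of blocks is bounded by that subgroup. -/
theorem IsMinimalProductOne.card_blocks_le {H : Type*} [Group H] {f : H →* G}
    (hf : Function.Injective f) {B : ℕ} (hB : AtomBound H B) {S : Multiset G}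
    (hS : IsMinimalProductOne S) (M : Multiset (List G))
    (hM : (M.map (fun l : List G => (l : Multiset G))).sum = S) (hne : ∀ l ∈ M, l ≠ [])
    (hr : ∀ l ∈ M, l.prod ∈ f.range) (h1 : IsProductOne (M.map List.prod)) : M.card ≤ B := by
  have hlift : ∃ T : Multiset H, T.map f = M.map List.prod := by
    refine ⟨(M.map List.prod).map (Function.invFun f), ?_⟩
    rw [Multiset.map_map, Multiset.map_map]
    refine Multiset.map_congr rfl fun l hl => ?_
    exact Function.invFun_eq (hr l hl)
  obtain ⟨T, hT⟩ := hlift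
  have hT1 : IsProductOne T := IsProductOne.of_map hf (hT ▸ h1)
  have hcard : T.card = M.card := by simpa using congrArg Multiset.card hT
  rw [← hcard]
  by_contra hlt
  have hT0 : T ≠ 0 := by rintro rfl; simp at hlt
  have hnm : ¬ IsMinimalProductOne T := fun h => hlt (hB T h)
  have : ∃ T₁ T₂ : Multiset H, T₁ ≠ 0 ∧ T₂ ≠ 0 ∧ T = T₁ + T₂ ∧
      IsProductOne T₁ ∧ IsProductOne T₂ := by
    by_contra h
    exact hnm ⟨hT0, hT1, h⟩
  obtain ⟨T₁, T₂, h₁, h₂, rfl, hp₁, hp₂⟩ := this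
  rw [Multiset.map_add] at hT
  obtain ⟨M₁, M₂, rfl, hM₁, hM₂⟩ := exists_add_of_map_eq_add _ _ _ _ hT.symm
  have key : ∀ N : Multiset (List G), (∀ l ∈ N, l ≠ []) →
      (N.map (fun l : List G => (l : Multiset G))).sum = 0 → N = 0 := by
    intro N hN h0
    by_contra hN0
    obtain ⟨l, hl⟩ := Multiset.exists_mem_of_ne_zero hN0
    obtain ⟨N', rfl⟩ := Multiset.exists_cons_of_mem hl
    rw [Multiset.map_cons, Multiset.sum_cons, add_eq_zero, Multiset.coe_eq_zero] at h0
    exact hN l hl h0.1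
  rw [Multiset.map_add, Multiset.sum_add] at hM
  rcases hS.eq_zero_or_eq_zero hM.symm
    (IsProductOne.sum_of_map_prod (hM₁ ▸ hp₁.map f))
    (IsProductOne.sum_of_map_prod (hM₂ ▸ hp₂.map f)) with h | h
  · have := key M₁ (fun l hl => hne l (by simp [hl])) h
    subst this
    exact h₁ (by simpa using hM₁.symm)
  · have := key M₂ (fun l hl => hne l (by simp [hl])) h
    subst this
    exact h₂ (by simpa using hM₂.symm)

theorem exists_blocks (H : Subgroup G) [DecidablePred (· ∈ H)] (g : G) (l : List G) :
    ((Finset.range (l.length + 1)).filter (fun i => g⁻¹ * (l.take i).prod ∈ H)).card = 0 ∨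
    ∃ (a : List G) (L : List (List G)) (c : List G), l = a ++ L.flatten ++ c ∧
      g⁻¹ * a.prod ∈ H ∧ (∀ b ∈ L, b ≠ [] ∧ b.prod ∈ H) ∧
      ((Finset.range (l.length + 1)).filter
        (fun i => g⁻¹ * (l.take i).prod ∈ H)).card ≤ L.length + 1 := by
  induction l using List.reverseRecOn with
  | nil =>
    by_cases hg : g⁻¹ ∈ H
    · right
      exact ⟨[], [], [], rfl, by simpa using hg, by simp, (Finset.card_filter_le _ _).trans (by simp)⟩
    · left
      simp [hg]
  | append_singleton l x ih =>
    have hcard : ((Finset.range ((l ++ [x]).length + 1)).filter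
        (fun i => g⁻¹ * ((l ++ [x]).take i).prod ∈ H)).card =
      ((Finset.range (l.length + 1)).filter (fun i => g⁻¹ * (l.take i).prod ∈ H)).card +
        if g⁻¹ * (l ++ [x]).prod ∈ H then 1 else 0 := by
      rw [List.length_append, List.length_singleton, Finset.range_add_one (n := l.length + 1),
        Finset.filter_insert]
      have h1 : (Finset.range (l.length + 1)).filter
          (fun i => g⁻¹ * ((l ++ [x]).take i).prod ∈ H) =
          (Finset.range (l.length + 1)).filter (fun i => g⁻¹ * (l.take i).prod ∈ H) := by
        refine Finset.filter_congr fun i hi => ?_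
        rw [List.take_append_of_le_length (by simpa [Nat.lt_succ_iff] using hi)]
      rw [h1, List.take_of_length_le (by simp)]
      split_ifs with hx
      · rw [Finset.card_insert_of_notMem (by simp)]
      · simp
    rw [hcard]
    rcases ih with h0 | ⟨a, L, c, rfl, ha, hL, hle⟩
    · by_cases hx : g⁻¹ * (l ++ [x]).prod ∈ H
      · right
        exact ⟨l ++ [x], [], [], by simp, hx, by simp, by rw [h0, if_pos hx]; simp⟩
      · left; rw [h0, if_neg hx]
    · right
      by_cases hx : g⁻¹ * (a ++ L.flatten ++ c ++ [x]).prod ∈ H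
      · refine ⟨a, L ++ [c ++ [x]], [], by simp, ha, ?_, ?_⟩
        · intro b hb
          rw [List.mem_append, List.mem_singleton] at hb
          rcases hb with hb | rfl
          · exact hL b hb
          refine ⟨by simp, ?_⟩
          have hf : L.flatten.prod ∈ H := by
            rw [List.prod_flatten]
            exact list_prod_mem (by simpa using fun b hb => (hL b hb).2)
          have := H.mul_mem (H.inv_mem (H.mul_mem ha hf)) hx
          simpa [mul_assoc] using this
        · rw [if_pos hx, List.length_append (as := L), List.length_singleton]; omega
      · exact ⟨a, L, c ++ [x], by simp, ha, hL, by rw [if_neg hx]; omega⟩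

theorem AtomBound.of_injective [Finite G] {H : Type*} [Group H] {f : H →* G}
    (hf : Function.Injective f) {B : ℕ} (hB : AtomBound H B) :
    AtomBound G (B * f.range.index) := by
  classical
  intro S hS
  obtain ⟨l, rfl, hl⟩ := id hS.2.1
  have : Fintype (G ⧸ f.range) := Fintype.ofFinite _
  rw [Subgroup.index, Nat.card_eq_fintype_card, Multiset.coe_card, ← Finset.card_range l.length,
    ← Finset.card_univ]
  refine Finset.card_le_mul_card_image_of_maps_to
    (f := fun i => ((l.take i).prod : G ⧸ f.range)) (fun _ _ => Finset.mem_univ _) B ?_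
  intro c _
  obtain ⟨g, rfl⟩ := QuotientGroup.mk_surjective c
  have hl0 : l ≠ [] := by rintro rfl; exact hS.1 rfl
  obtain ⟨l', x, rfl⟩ := (List.eq_nil_or_concat' l).resolve_left hl0
  have hset : (Finset.range (l' ++ [x]).length).filter
      (fun i => (((l' ++ [x]).take i).prod : G ⧸ f.range) = (g : G ⧸ f.range)) =
      (Finset.range (l'.length + 1)).filter (fun i => g⁻¹ * (l'.take i).prod ∈ f.range) := by
    rw [List.length_append, List.length_singleton]
    refine Finset.filter_congr fun i hi => ?_
    rw [List.take_append_of_le_length (by simpa [Nat.lt_succ_iff] using hi), eq_comm,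
      QuotientGroup.eq]
  rw [hset]
  rcases exists_blocks f.range g l' with h0 | ⟨a, L, c, rfl, ha, hL, hle⟩
  · omega
  refine hle.trans ?_
  have hf' : L.flatten.prod ∈ f.range := by
    rw [List.prod_flatten]
    exact list_prod_mem (by simpa using fun b hb => (hL b hb).2)
  have hcyc : (L.flatten ++ (c ++ [x] ++ a)).prod = 1 := by
    have := prod_append_comm_eq_one (a := a) (b := L.flatten ++ (c ++ [x])) (by simpa using hl)
    simpa using this
  have hlast : (c ++ [x] ++ a).prod ∈ f.range := by
    rw [List.prod_append] at hcyc
    rw [← inv_eq_of_mul_eq_one_right hcyc]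
    exact f.range.inv_mem hf'
  have := hS.card_blocks_le hf hB (((L ++ [c ++ [x] ++ a]) : List (List G)) : Multiset (List G))
    ?_ ?_ ?_ ?_
  · simpa using this
  · have : ∀ L : List (List G), ((L : Multiset (List G)).map (fun l : List G => (l : Multiset G))).sum =
        (L.flatten : Multiset G) := by
      intro L
      induction L with
      | nil => rfl
      | cons a L ih => simp_all [← Multiset.coe_add]
    rw [this, List.flatten_append]
    simp only [← Multiset.coe_add, List.flatten_singleton]
    abel
  · intro b hb
    rw [Multiset.mem_coe, List.mem_append, List.mem_singleton] at hb
    rcases hb with hb | rfl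
    · exact (hL b hb).1
    · simp
  · intro b hb
    rw [Multiset.mem_coe, List.mem_append, List.mem_singleton] at hb
    rcases hb with hb | rfl
    · exact (hL b hb).2
    · exact hlast
  · rw [Multiset.map_coe]
    apply isProductOne_coe
    rw [← List.prod_flatten, List.flatten_append, List.flatten_singleton]
    exact hcyc

end

theorem IsProductOne.exists_factorization {G : Type*} [Group G] {S : Multiset G}
    (hS : IsProductOne S) :
    ∃ M : Multiset (Multiset G), M.sum = S ∧ ∀ T ∈ M, IsMinimalProductOne T := by
  induction h : S.card using Nat.strong_induction_on generalizing S with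
  | _ n ih =>
    by_cases h0 : S = 0
    · exact ⟨0, by simp [h0], by simp⟩
    by_cases hm : IsMinimalProductOne S
    · exact ⟨{S}, by simp, by simpa using hm⟩
    have : ∃ T₁ T₂ : Multiset G, T₁ ≠ 0 ∧ T₂ ≠ 0 ∧ S = T₁ + T₂ ∧
        IsProductOne T₁ ∧ IsProductOne T₂ := by
      by_contra hc
      exact hm ⟨h0, hS, hc⟩
    obtain ⟨T₁, T₂, h₁, h₂, rfl, hp₁, hp₂⟩ := this
    have c₁ := Multiset.card_pos.2 h₁
    have c₂ := Multiset.card_pos.2 h₂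
    rw [Multiset.card_add] at h
    obtain ⟨M₁, rfl, hM₁⟩ := ih _ (by omega) hp₁ rfl
    obtain ⟨M₂, rfl, hM₂⟩ := ih _ (by omega) hp₂ rfl
    exact ⟨M₁ + M₂, by simp, fun T hT => (Multiset.mem_add.1 hT).elim (hM₁ T) (hM₂ T)⟩

theorem exists_lists_of_factorization {G H : Type*} [Group G] [Group H] (f : G →* H)
    (M : Multiset (Multiset H)) (hM : ∀ T ∈ M, IsMinimalProductOne T) (S : Multiset G)
    (hS : M.sum = S.map f) : ∃ P : Multiset (List G),
      (P.map (fun l : List G => (l : Multiset G))).sum = S ∧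
      ∀ l ∈ P, l.prod ∈ f.ker ∧ IsMinimalProductOne ((l : Multiset G).map f) := by
  induction M using Multiset.induction_on generalizing S with
  | empty => exact ⟨0, by simpa [eq_comm] using hS, by simp⟩
  | cons T M ih =>
    rw [Multiset.sum_cons] at hS
    obtain ⟨S₁, S₂, rfl, rfl, h₂⟩ := exists_add_of_map_eq_add _ _ _ _ hS.symm
    obtain ⟨P, rfl, hP⟩ := ih (fun T hT => hM T (by simp [hT])) S₂ h₂.symm
    have hT := hM _ (Multiset.mem_cons_self _ _)
    obtain ⟨l, hl, hl1⟩ := id hT.2.1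
    obtain ⟨L, rfl, rfl⟩ := exists_list_of_coe_eq_map _ _ _ hl
    refine ⟨L ::ₘ P, by simp, ?_⟩
    intro l hl
    rw [Multiset.mem_cons] at hl
    rcases hl with rfl | hl
    · exact ⟨by rw [MonoidHom.mem_ker, map_list_prod, hl1], hT⟩
    · exact hP l hl

theorem coe_flatten {α : Type*} (L : List (List α)) :
    (L.flatten : Multiset α) =
      ((L : Multiset (List α)).map (fun l : List α => (l : Multiset α))).sum := by
  induction L with
  | nil => rfl
  | cons a L ih => simp_all [← Multiset.coe_add]

theorem AtomBound.of_ker_inf_commutator {G H : Type*} [Group G] [Group H] [Finite G] (f : G →* H)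
    (hf : f.ker ⊓ commutator G = ⊥) {B : ℕ} (hB : AtomBound H B) :
    AtomBound G (Nat.card f.ker * B) := by
  intro S hS
  obtain ⟨M, hMS, hM⟩ := (hS.2.1.map f).exists_factorization
  obtain ⟨P, hPS, hP⟩ := exists_lists_of_factorization f M hM S hMS
  have hne : ∀ l ∈ P, l ≠ [] := by
    rintro l hl rfl
    exact (hP _ hl).2.1 rfl
  have h1 : IsProductOne (P.map List.prod) := by
    obtain ⟨L, rfl⟩ := Quot.exists_rep P
    change IsProductOne ((L : Multiset (List G)).map List.prod)
    rw [Multiset.map_coe]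
    apply isProductOne_coe
    rw [← List.prod_flatten, ← Subgroup.mem_bot, ← hf]
    refine Subgroup.mem_inf.2 ⟨?_, ?_⟩
    · rw [List.prod_flatten]
      refine list_prod_mem ?_
      intro x hx
      obtain ⟨l, hl, rfl⟩ := List.mem_map.1 hx
      exact (hP l hl).1
    · obtain ⟨l₀, hl₀, hp₀⟩ := id hS.2.1
      rw [← Abelianization.ker_of, MonoidHom.mem_ker, ← map_one Abelianization.of, ← hp₀,
        map_list_prod, map_list_prod, ← Multiset.prod_coe, ← Multiset.prod_coe,
        ← Multiset.map_coe, ← Multiset.map_coe, hl₀, ← hPS, coe_flatten]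
      rfl
  have hc := hS.card_blocks_le f.ker.subtype_injective (atomBound_card f.ker) P hPS hne
    (fun l hl => by simpa using (hP l hl).1) h1
  refine le_trans ?_ (Nat.mul_le_mul_right B hc)
  rw [← hPS]
  have hb : ∀ l ∈ P, l.length ≤ B := fun l hl => by simpa using hB _ (hP l hl).2
  clear hPS hP hne h1 hc
  induction P using Multiset.induction_on with
  | empty => simp
  | cons l P ih =>
    have h1 := hb l (by simp)
    have h2 := ih fun l hl => hb l (by simp [hl])
    rw [Multiset.map_cons, Multiset.sum_cons, Multiset.card_add, Multiset.card_cons,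
      Multiset.coe_card, add_mul]
    omega

/-- A faithful affine action of `G` on `ZMod q`, given by its multiplier `χ` and its
translation part `τ`, in which every multiplier has order dividing `r`. -/
structure AffineData (G : Type*) [Group G] (q r : ℕ) where
  χ : G →* (ZMod q)ˣ
  τ : G → ZMod q
  τ_mul : ∀ g h, τ (g * h) = τ g + χ g * τ h
  eq_one : ∀ g, χ g = 1 → τ g = 0 → g = 1
  pow_eq_one : ∀ g, χ g ^ r = 1

theorem le_card_of_forall_mul_mem {M : Type*} [Group M] {r : ℕ} {D : Finset M} {u : M}
    (hu : orderOf u = r) (h0 : D.Nonempty) (h : ∀ x ∈ D, u * x ∈ D) : r ≤ D.card := by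
  obtain ⟨x, hx⟩ := h0
  have hk : ∀ k : ℕ, u ^ k * x ∈ D := by
    intro k
    induction k with
    | zero => simpa using hx
    | succ k ih => simpa [pow_succ', mul_assoc] using h _ ih
  have := Finset.card_le_card_of_injOn (s := Finset.range r) (t := D)
    (fun k => u ^ k * x) (fun k _ => hk k) ?_
  · rwa [Finset.card_range] at this
  · intro i hi j hj hij
    simp only [Finset.coe_range, Set.mem_Iio] at hi hj
    refine pow_injOn_Iio_orderOf (x := u) ?_ ?_ (mul_right_cancel hij)
    · simpa [hu] using hi
    · simpa [hu] using hj

theorem exists_le_card_eq {α : Type*} {S : Multiset α} {n : ℕ} (h : n ≤ S.card) :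
    ∃ T ≤ S, T.card = n := by
  obtain ⟨l, rfl⟩ := Quot.exists_rep S
  exact ⟨(l.take n : List α), (List.take_sublist n l).subperm, by simpa using h⟩

namespace AffineData

variable {G : Type*} [Group G] {q r : ℕ} [Fact q.Prime] (A : AffineData G q r)

theorem τ_one : A.τ 1 = 0 := by
  have := A.τ_mul 1 1
  simpa using this

theorem τ_inv (g : G) : A.τ g⁻¹ = -(((A.χ g)⁻¹ : (ZMod q)ˣ) * A.τ g) := by
  have h := A.τ_mul g⁻¹ g
  rw [inv_mul_cancel, τ_one, map_inv] at h
  exact eq_neg_of_add_eq_zero_left h.symm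

theorem ext_of_eq {g h : G} (hχ : A.χ g = A.χ h) (hτ : A.τ g = A.τ h) : g = h := by
  have : g⁻¹ * h = 1 := by
    apply A.eq_one
    · simp [hχ]
    · rw [A.τ_mul, A.τ_inv, hτ, map_inv]
      ring
  exact (inv_mul_eq_one.1 this)

theorem τ_conj_of_mul {a b : G} (h : A.χ (a * b) = 1) :
    A.τ (b * a) = ((A.χ a)⁻¹ : (ZMod q)ˣ) * A.τ (a * b) := by
  rw [map_mul] at h
  have hb : A.χ b = (A.χ a)⁻¹ := eq_inv_of_mul_eq_one_right h
  rw [A.τ_mul, A.τ_mul, hb, mul_add, ← mul_assoc, ← Units.val_mul, inv_mul_cancel,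
    Units.val_one, one_mul, add_comm]

/-- The multiplier of a product of the terms of `S`. -/
def cls (S : Multiset G) : (ZMod q)ˣ := (S.map A.χ).prod

@[simp] theorem cls_zero : A.cls 0 = 1 := by simp [cls]

@[simp] theorem cls_add (S T : Multiset G) : A.cls (S + T) = A.cls S * A.cls T := by simp [cls]

@[simp] theorem cls_cons (g : G) (S : Multiset G) : A.cls (g ::ₘ S) = A.χ g * A.cls S := by
  simp [cls]

@[simp] theorem cls_singleton (g : G) : A.cls {g} = A.χ g := by simp [cls]

theorem cls_coe (l : List G) : A.cls (l : Multiset G) = A.χ l.prod := by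
  simp [cls, map_list_prod]

theorem cls_pow (S : Multiset G) : A.cls S ^ r = 1 := by
  obtain ⟨l, rfl⟩ := Quot.exists_rep S
  exact (congrArg (· ^ r) (A.cls_coe l)).trans (A.pow_eq_one _)

theorem cls_eq_one_of_forall {S : Multiset G} (h : ∀ g ∈ S, A.χ g = 1) : A.cls S = 1 := by
  induction S using Multiset.induction_on with
  | empty => simp
  | cons a S ih => simp [h a (by simp), ih fun g hg => h g (by simp [hg])]

open Classical in
/-- The translation parts of the products of the terms of `S`, over all orderings. -/
noncomputable def vals (S : Multiset G) : Finset (ZMod q) :=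
  Finset.univ.filter fun v => ∃ l : List G, (l : Multiset G) = S ∧ A.τ l.prod = v

variable {A}

theorem mem_vals {S : Multiset G} {v : ZMod q} :
    v ∈ A.vals S ↔ ∃ l : List G, (l : Multiset G) = S ∧ A.τ l.prod = v := by
  simp [vals]

theorem mem_vals_coe (l : List G) : A.τ l.prod ∈ A.vals (l : Multiset G) :=
  mem_vals.2 ⟨l, rfl, rfl⟩

theorem vals_nonempty (S : Multiset G) : (A.vals S).Nonempty := by
  obtain ⟨l, rfl⟩ := Quot.exists_rep S
  exact ⟨_, mem_vals_coe l⟩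

theorem add_mem_vals {S T : Multiset G} {v w : ZMod q} (hv : v ∈ A.vals S) (hw : w ∈ A.vals T) :
    v + A.cls S * w ∈ A.vals (S + T) := by
  obtain ⟨l, rfl, rfl⟩ := mem_vals.1 hv
  obtain ⟨l', rfl, rfl⟩ := mem_vals.1 hw
  exact mem_vals.2 ⟨l ++ l', by simp, by rw [List.prod_append, A.τ_mul, cls_coe]⟩

theorem isProductOne_iff {S : Multiset G} :
    IsProductOne S ↔ A.cls S = 1 ∧ 0 ∈ A.vals S := by
  constructor
  · rintro ⟨l, rfl, hl⟩
    refine ⟨by rw [cls_coe, hl, map_one], mem_vals.2 ⟨l, rfl, by rw [hl, τ_one]⟩⟩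
  · rintro ⟨h, h0⟩
    obtain ⟨l, rfl, hl⟩ := mem_vals.1 h0
    rw [cls_coe] at h
    exact isProductOne_coe (A.eq_one _ h hl)

variable (A) in
/-- The terms of `T` can be ordered to give at least `a + 1` translation parts (or all). -/
def Gain (T : Multiset G) (a : ℕ) : Prop := min q (a + 1) ≤ (A.vals T).card

theorem gain_zero (T : Multiset G) : A.Gain T 0 :=
  (min_le_right _ _).trans (Finset.card_pos.2 (vals_nonempty T))

theorem Gain.of_le {T : Multiset G} {a b : ℕ} (h : A.Gain T a) (hb : b ≤ a) : A.Gain T b :=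
  le_trans (min_le_min le_rfl (by omega)) h

theorem card_image_add_unit_mul (s : Finset (ZMod q)) (c : ZMod q) (u : (ZMod q)ˣ) :
    (s.image fun x => c + u * x).card = s.card := by
  apply Finset.card_image_of_injective
  intro x y h
  simpa using h

open Pointwise in
theorem Gain.add {S T : Multiset G} {a b : ℕ} (hS : A.Gain S a) (hT : A.Gain T b) :
    A.Gain (S + T) (a + b) := by
  classical
  have h := ZMod.cauchy_davenport (p := q) Fact.out (vals_nonempty (A := A) S)
    ((vals_nonempty (A := A) T).image fun x => 0 + (A.cls S : ZMod q) * x)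
  rw [card_image_add_unit_mul] at h
  have hsub : A.vals S + (A.vals T).image (fun x => 0 + (A.cls S : ZMod q) * x) ⊆
      A.vals (S + T) := by
    intro x hx
    obtain ⟨v, hv, w, hw, rfl⟩ := Finset.mem_add.1 hx
    obtain ⟨w', hw', rfl⟩ := Finset.mem_image.1 hw
    rw [zero_add]
    exact add_mem_vals hv hw'
  have h' := h.trans (Finset.card_le_card hsub)
  unfold Gain at *
  omega

theorem Gain.mono {S T : Multiset G} {a : ℕ} (hS : A.Gain S a) (h : S ≤ T) : A.Gain T a := by
  obtain ⟨U, rfl⟩ := Multiset.le_iff_exists_add.1 h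
  exact hS.add (gain_zero U)

theorem IsMinimalProductOne.false_of_gain {S Z T : Multiset G} (hS : IsMinimalProductOne S)
    (hZT : Z + T ≤ S) (hZ : Z ≠ 0) (hZ1 : IsProductOne Z) (hT : A.Gain T (q - 1)) : False := by
  have hq : 1 < q := (Fact.out : q.Prime).one_lt
  obtain ⟨U, rfl⟩ := Multiset.le_iff_exists_add.1 hZT
  have hg : A.Gain (T + U) (q - 1) := hT.add (gain_zero U)
  have huniv : A.vals (T + U) = Finset.univ := by
    rw [← Finset.card_eq_iff_eq_univ, ZMod.card]
    refine le_antisymm ((Finset.card_le_univ _).trans_eq (ZMod.card q)) ?_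
    have : min q (q - 1 + 1) ≤ (A.vals (T + U)).card := hg
    omega
  have hcls : A.cls (T + U) = 1 := by
    have h1 := (isProductOne_iff (A := A)).1 hS.2.1
    have h2 := (isProductOne_iff (A := A)).1 hZ1
    rw [add_assoc, cls_add, h2.1, one_mul] at h1
    exact h1.1
  rcases hS.eq_zero_or_eq_zero (add_assoc Z T U) hZ1
    ((isProductOne_iff (A := A)).2 ⟨hcls, huniv ▸ Finset.mem_univ _⟩) with h | h
  · exact hZ h
  · rw [h] at huniv
    have h2 : (A.vals 0).card = q := by rw [huniv, Finset.card_univ, ZMod.card]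
    have h3 : A.vals 0 ⊆ {0} := by
      intro x hx
      obtain ⟨l, hl, rfl⟩ := mem_vals.1 hx
      rw [Multiset.coe_eq_zero] at hl
      simp [hl, τ_one]
    have := Finset.card_le_card h3
    rw [h2, Finset.card_singleton] at this
    omega

/-! ### Colours -/

open Classical in
variable (A) in
/-- The fixed point of `g` on `ZMod q`, or `none` for translations. -/
noncomputable def col (g : G) : Option (ZMod q) :=
  if A.χ g = 1 then none else some (A.τ g / (1 - A.χ g))

theorem col_eq_none {g : G} : A.col g = none ↔ A.χ g = 1 := by
  unfold col; split_ifs <;> simp_all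

theorem one_sub_ne_zero {u : (ZMod q)ˣ} (h : u ≠ 1) : (1 : ZMod q) - u ≠ 0 := by
  intro h0
  exact h (Units.ext (by simpa using (sub_eq_zero.1 h0).symm))

theorem col_eq_some {g : G} {f : ZMod q} (hg : A.χ g ≠ 1) :
    A.col g = some f ↔ A.τ g = f * (1 - A.χ g) := by
  unfold col
  rw [if_neg hg, Option.some_inj, div_eq_iff (one_sub_ne_zero hg)]

theorem τ_ne_zero {g : G} (hg : g ≠ 1) (h : A.χ g = 1) : A.τ g ≠ 0 := fun h0 =>
  hg (A.eq_one g h h0)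

theorem τ_mul_ne_of_col_ne {g h : G} (hg : g ≠ 1) (hh : h ≠ 1) (hc : A.col g ≠ A.col h) :
    A.τ (g * h) ≠ A.τ (h * g) := by
  rw [A.τ_mul, A.τ_mul]
  intro he
  by_cases h1 : A.χ g = 1 <;> by_cases h2 : A.χ h = 1
  · exact hc (by rw [col_eq_none.2 h1, col_eq_none.2 h2])
  · have := one_sub_ne_zero h2
    have h3 := τ_ne_zero hg h1
    rw [h1, Units.val_one] at he
    exact mul_ne_zero this h3 (by linear_combination he)
  · have := one_sub_ne_zero h1
    have h3 := τ_ne_zero hh h2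
    rw [h2, Units.val_one] at he
    exact mul_ne_zero this h3 (by linear_combination -he)
  · refine hc ?_
    have n1 := one_sub_ne_zero h1
    have n2 := one_sub_ne_zero h2
    unfold col
    rw [if_neg h1, if_neg h2, Option.some_inj, div_eq_div_iff n1 n2]
    linear_combination he

theorem τ_list_prod {f : ZMod q} {l : List G} (h : ∀ g ∈ l, A.τ g = f * (1 - A.χ g)) :
    A.τ l.prod = f * (1 - A.χ l.prod) := by
  induction l with
  | nil => simp [τ_one]
  | cons g l ih =>
    rw [List.prod_cons, A.τ_mul, h g (by simp), ih fun x hx => h x (by simp [hx]), map_mul,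
      Units.val_mul]
    ring

theorem τ_eq_of_col {f : ZMod q} {g : G} (h : A.col g = some f) : A.τ g = f * (1 - A.χ g) := by
  refine (col_eq_some ?_).1 h
  rw [Ne, ← col_eq_none, h]
  simp

theorem χ_ne_one_of_col {f : ZMod q} {g : G} (h : A.col g = some f) : A.χ g ≠ 1 := by
  rw [Ne, ← col_eq_none, h]
  simp

theorem τ_sub_ne_zero {f : ZMod q} {g : G} (hg : g ≠ 1) (h : A.col g ≠ some f) :
    A.τ g - f * (1 - A.χ g) ≠ 0 := by
  by_cases h1 : A.χ g = 1
  · simpa [h1] using τ_ne_zero hg h1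
  · rw [Ne, col_eq_some h1] at h
    exact sub_ne_zero.2 h

theorem gain_pair {g h : G} (hg : g ≠ 1) (hh : h ≠ 1) (hc : A.col g ≠ A.col h) :
    A.Gain {g, h} 1 := by
  have h1 : A.τ (g * h) ∈ A.vals {g, h} := mem_vals.2 ⟨[g, h], rfl, by simp⟩
  have h2 : A.τ (h * g) ∈ A.vals {g, h} := mem_vals.2 ⟨[h, g], Multiset.pair_comm h g, by simp⟩
  have : 1 < (A.vals {g, h}).card :=
    Finset.one_lt_card.2 ⟨_, h1, _, h2, τ_mul_ne_of_col_ne hg hh hc⟩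
  exact (min_le_right _ _).trans this

open Pointwise in
/-- Inserting translations into a fixed list at places with different multipliers. -/
theorem gain_insert {as : List G} {D : Finset (ZMod q)ˣ}
    (hD : ∀ p ∈ D, ∃ l₁ l₂, as = l₁ ++ l₂ ∧ A.χ l₁.prod = p) {i : ℕ} (hi : i + 1 ≤ D.card)
    {X : Multiset G} (hX : ∀ x ∈ X, x ≠ 1 ∧ A.χ x = 1) :
    A.Gain ((as : Multiset G) + X) (i * X.card) := by
  classical
  suffices h : ∃ F : Finset (ZMod q), min q (i * X.card + 1) ≤ F.card ∧
      ∀ v ∈ F, ∃ l : List G, (l : Multiset G) = as + X ∧ A.τ l.prod = v ∧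
        ∀ p ∈ D, ∃ l₁ l₂, l = l₁ ++ l₂ ∧ A.χ l₁.prod = p by
    obtain ⟨F, hF, h⟩ := h
    refine hF.trans (Finset.card_le_card fun v hv => ?_)
    obtain ⟨l, hl, hv, -⟩ := h v hv
    exact mem_vals.2 ⟨l, hl, hv⟩
  induction X using Multiset.induction_on with
  | empty =>
    refine ⟨{A.τ as.prod}, by simp, ?_⟩
    intro v hv
    rw [Finset.mem_singleton] at hv
    exact ⟨as, by simp, hv.symm, hD⟩
  | cons x X ih =>
    obtain ⟨F, hF, h⟩ := ih fun y hy => hX y (by simp [hy])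
    obtain ⟨hx1, hx⟩ := hX x (by simp)
    have hτ := τ_ne_zero hx1 hx
    have hcI : (D.image fun p : (ZMod q)ˣ => (p : ZMod q) * A.τ x).card = D.card := by
      apply Finset.card_image_of_injective
      intro p p' hp
      exact Units.ext (mul_right_cancel₀ hτ hp)
    have hF0 : F.Nonempty := by
      have : 0 < q := (Fact.out : q.Prime).pos
      rw [← Finset.card_pos]; omega
    have hD0 : D.Nonempty := by rw [← Finset.card_pos]; omega
    refine ⟨F + D.image fun p : (ZMod q)ˣ => (p : ZMod q) * A.τ x, ?_, ?_⟩
    · have := ZMod.cauchy_davenport (p := q) Fact.out hF0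
        (hD0.image fun p : (ZMod q)ˣ => (p : ZMod q) * A.τ x)
      rw [hcI] at this
      rw [Multiset.card_cons, mul_add, mul_one]
      omega
    · intro v hv
      obtain ⟨v', hv', w, hw, rfl⟩ := Finset.mem_add.1 hv
      obtain ⟨p, hp, rfl⟩ := Finset.mem_image.1 hw
      obtain ⟨l, hl, rfl, hs⟩ := h v' hv'
      obtain ⟨l₁, l₂, rfl, rfl⟩ := hs p hp
      refine ⟨l₁ ++ x :: l₂, ?_, ?_, ?_⟩
      · rw [Multiset.add_cons, ← hl, ← Multiset.coe_add, ← Multiset.coe_add,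
          ← Multiset.cons_coe, Multiset.add_cons]
      · simp only [List.prod_append, List.prod_cons, A.τ_mul, hx, Units.val_one]
        ring
      · intro p' hp'
        obtain ⟨m₁, m₂, hm, rfl⟩ := hs p' hp'
        rcases List.append_eq_append_iff.1 hm with ⟨c, rfl, rfl⟩ | ⟨c, rfl, rfl⟩
        · exact ⟨l₁ ++ x :: c, m₂, by simp, by simp [hx]⟩
        · exact ⟨m₁, c ++ x :: l₂, by simp, rfl⟩

theorem gain_insert_one {g : G} (hg : A.χ g ≠ 1) {X : Multiset G}
    (hX : ∀ x ∈ X, x ≠ 1 ∧ A.χ x = 1) : A.Gain (g ::ₘ X) X.card := by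
  classical
  have := gain_insert (A := A) (as := [g]) (D := {1, A.χ g}) (i := 1) ?_ ?_ hX
  · simpa using this
  · intro p hp
    rw [Finset.mem_insert, Finset.mem_singleton] at hp
    rcases hp with rfl | rfl
    · exact ⟨[], [g], rfl, by simp⟩
    · exact ⟨[g], [], rfl, by simp⟩
  · rw [Finset.card_pair (Ne.symm hg)]

theorem gain_insert_two {a b : G} (ha : A.χ a ≠ 1) (hb : A.χ b ≠ 1) (hab : A.χ a * A.χ b ≠ 1)
    {X : Multiset G} (hX : ∀ x ∈ X, x ≠ 1 ∧ A.χ x = 1) :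
    A.Gain ({a, b} + X) (2 * X.card) := by
  classical
  refine gain_insert (A := A) (as := [a, b]) (D := {1, A.χ a, A.χ a * A.χ b}) (i := 2) ?_ ?_ hX
  · intro p hp
    simp only [Finset.mem_insert, Finset.mem_singleton] at hp
    rcases hp with rfl | rfl | rfl
    · exact ⟨[], [a, b], rfl, by simp⟩
    · exact ⟨[a], [b], rfl, by simp⟩
    · exact ⟨[a, b], [], rfl, by simp⟩
  · rw [Finset.card_insert_of_notMem, Finset.card_pair]
    · simpa using hb
    · simp [Ne.symm ha, Ne.symm hab]

end AffineData

namespace AffineData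

variable {G : Type*} [Group G] {q r : ℕ} [Fact q.Prime] [Fact r.Prime] {A : AffineData G q r}

theorem orderOf_eq {u : (ZMod q)ˣ} (hu : u ^ r = 1) (hu1 : u ≠ 1) : orderOf u = r :=
  orderOf_eq_prime hu hu1

theorem exists_affine_notMem {X : Finset (ZMod q)} {u : (ZMod q)ˣ} (hu : u ^ r = 1) (hu1 : u ≠ 1)
    (d : ZMod q) (h2 : 2 ≤ X.card) (hX : X.card < r) : ∃ x ∈ X, d + u * x ∉ X := by
  by_contra! h
  have hs := one_sub_ne_zero hu1
  obtain ⟨f, rfl⟩ : ∃ f, d = f * (1 - u) := ⟨d / (1 - u), by field_simp⟩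
  obtain ⟨x, hx, hxf⟩ := Finset.exists_mem_ne (by omega : 1 < X.card) f
  have hk : ∀ k : ℕ, f + (u : ZMod q) ^ k * (x - f) ∈ X := by
    intro k
    induction k with
    | zero => simpa using hx
    | succ k ih =>
      have := h _ ih
      convert this using 1
      ring
  have := Finset.card_le_card_of_injOn (s := Finset.range r) (t := X)
    (fun k => f + (u : ZMod q) ^ k * (x - f)) (fun k _ => hk k) ?_
  · rw [Finset.card_range] at this
    omega
  · intro i hi j hj hij
    simp only [Finset.coe_range, Set.mem_Iio] at hi hj
    have h1 : (u : ZMod q) ^ i = (u : ZMod q) ^ j :=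
      mul_right_cancel₀ (sub_ne_zero.2 hxf) (add_left_cancel hij)
    refine pow_injOn_Iio_orderOf (x := u) ?_ ?_ (Units.ext (by simpa using h1))
    · simpa [orderOf_eq hu hu1] using hi
    · simpa [orderOf_eq hu hu1] using hj

theorem Gain.cons {T : Multiset G} {a : ℕ} (hT : A.Gain T a) {g : G} (hg : A.χ g ≠ 1)
    (ha : 1 ≤ a) (har : a + 1 < r) (hrq : r < q) : A.Gain (g ::ₘ T) (a + 1) := by
  classical
  by_cases hlarge : min q (a + 1 + 1) ≤ (A.vals T).card
  · have : A.Gain T (a + 1) := hlarge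
    exact this.mono (Multiset.le_cons_self T g)
  have hT' : min q (a + 1) ≤ (A.vals T).card := hT
  have hcard : (A.vals T).card = a + 1 := by omega
  set X := A.vals T with hX
  set Y := X.image (fun x => A.τ g + (A.χ g : ZMod q) * x) with hY
  set Y' := X.image (fun x => A.cls T * A.τ g + ((1 : (ZMod q)ˣ) : ZMod q) * x) with hY'
  have hYs : Y ⊆ A.vals (g ::ₘ T) := by
    intro y hy
    obtain ⟨x, hx, rfl⟩ := Finset.mem_image.1 hy
    obtain ⟨l, hl, rfl⟩ := mem_vals.1 hx
    exact mem_vals.2 ⟨g :: l, by rw [← hl]; rfl, by rw [List.prod_cons, A.τ_mul]⟩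
  have hYs' : Y' ⊆ A.vals (g ::ₘ T) := by
    intro y hy
    obtain ⟨x, hx, rfl⟩ := Finset.mem_image.1 hy
    obtain ⟨l, hl, rfl⟩ := mem_vals.1 hx
    refine mem_vals.2 ⟨l ++ [g], ?_, ?_⟩
    · rw [← hl, ← Multiset.coe_add, add_comm]; rfl
    · rw [List.prod_append, A.τ_mul, List.prod_singleton, ← hl, cls_coe]
      simp [add_comm]
  have cY : Y.card = a + 1 := by rw [← hcard]; exact card_image_add_unit_mul _ _ _
  have cY' : Y'.card = a + 1 := by rw [← hcard]; exact card_image_add_unit_mul _ _ _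
  have hne : ¬ Y ⊆ Y' := by
    intro hsub
    obtain ⟨x, hx, hxn⟩ := exists_affine_notMem (r := r) (A.pow_eq_one g) hg
      (A.τ g - A.cls T * A.τ g) (X := X) (by omega) (by omega)
    obtain ⟨x', hx', he⟩ := Finset.mem_image.1 (hsub (Finset.mem_image_of_mem _ hx))
    apply hxn
    convert hx' using 1
    rw [Units.val_one] at he
    linear_combination -he
  have hlt : Y'.card < (Y ∪ Y').card := by
    apply Finset.card_lt_card
    rw [Finset.ssubset_iff_subset_ne]
    refine ⟨Finset.subset_union_right, fun h => hne ?_⟩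
    rw [h]
    exact Finset.subset_union_left
  have := Finset.card_le_card (Finset.union_subset hYs hYs')
  unfold Gain
  omega

theorem gain_insert_replicate {e : (ZMod q)ˣ} (he : e ≠ 1) (her : e ^ r = 1) {l : List G}
    (hl : ∀ g ∈ l, A.χ g = e) (hlen : l.length + 1 = r) {X : Multiset G}
    (hX : ∀ x ∈ X, x ≠ 1 ∧ A.χ x = 1) :
    A.Gain ((l : Multiset G) + X) ((r - 1) * X.card) := by
  classical
  refine gain_insert (A := A) (D := (Finset.range r).image fun k => e ^ k) ?_ ?_ hX
  · intro p hp
    obtain ⟨k, hk, rfl⟩ := Finset.mem_image.1 hp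
    rw [Finset.mem_range] at hk
    refine ⟨l.take k, l.drop k, by simp, ?_⟩
    rw [map_list_prod, List.prod_eq_pow_card _ e]
    · simp; congr 1; omega
    · intro x hx
      obtain ⟨g, hg, rfl⟩ := List.mem_map.1 hx
      exact hl g (List.mem_of_mem_take hg)
  · rw [Finset.card_image_of_injOn, Finset.card_range]
    · omega
    · intro i hi j hj hij
      simp only [Finset.coe_range, Set.mem_Iio] at hi hj
      refine pow_injOn_Iio_orderOf (x := e) ?_ ?_ hij
      · simpa [orderOf_eq her he] using hi
      · simpa [orderOf_eq her he] using hj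

/-- Choosing one multiset from each pair realizes many multipliers. -/
theorem exists_choices (L : List (Multiset G × Multiset G))
    (hL : ∀ x ∈ L, A.cls x.1 ≠ A.cls x.2) :
    ∃ D : Finset (ZMod q)ˣ, min r (L.length + 1) ≤ D.card ∧
      ∀ p ∈ D, ∃ a b : Multiset G, a + b = (L.map fun x => x.1 + x.2).sum ∧ A.cls a = p ∧
        ((∀ x ∈ L, x.1.card = x.2.card) → a.card = b.card) := by
  classical
  induction L with
  | nil => exact ⟨{1}, by simp, fun p hp => ⟨0, 0, by simp, by simpa [eq_comm] using hp, by simp⟩⟩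
  | cons x L ih =>
    obtain ⟨D, hD, h⟩ := ih fun y hy => hL y (by simp [hy])
    have hx := hL x (by simp)
    have hr : 0 < r := (Fact.out : r.Prime).pos
    refine ⟨D.image (A.cls x.1 * ·) ∪ D.image (A.cls x.2 * ·), ?_, ?_⟩
    · have c1 : (D.image (A.cls x.1 * ·)).card = D.card :=
        Finset.card_image_of_injective _ (mul_right_injective _)
      have c2 : (D.image (A.cls x.2 * ·)).card = D.card :=
        Finset.card_image_of_injective _ (mul_right_injective _)
      have h1 : (D.image (A.cls x.1 * ·)).card ≤
        (D.image (A.cls x.1 * ·) ∪ D.image (A.cls x.2 * ·)).card :=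
        Finset.card_le_card Finset.subset_union_left
      by_cases hsub : D.image (A.cls x.2 * ·) ⊆ D.image (A.cls x.1 * ·)
      · have : r ≤ D.card := by
          refine le_card_of_forall_mul_mem (u := (A.cls x.1)⁻¹ * A.cls x.2) ?_ ?_ ?_
          · refine orderOf_eq ?_ ?_
            · rw [mul_pow, inv_pow, cls_pow, cls_pow]; simp
            · rw [Ne, inv_mul_eq_one]; exact hx
          · rw [← Finset.card_pos]; omega
          · intro y hy
            obtain ⟨z, hz, he⟩ := Finset.mem_image.1 (hsub (Finset.mem_image_of_mem _ hy))
            rw [mul_assoc, ← he]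
            simpa using hz
        omega
      · have : (D.image (A.cls x.1 * ·)).card <
          (D.image (A.cls x.1 * ·) ∪ D.image (A.cls x.2 * ·)).card := by
          apply Finset.card_lt_card
          rw [Finset.ssubset_iff_subset_ne]
          refine ⟨Finset.subset_union_left, fun h => hsub ?_⟩
          rw [h]
          exact Finset.subset_union_right
        rw [List.length_cons]
        omega
    · intro p hp
      rw [Finset.mem_union, Finset.mem_image, Finset.mem_image] at hp
      rcases hp with ⟨p, hp, rfl⟩ | ⟨p, hp, rfl⟩ <;> obtain ⟨a, b, hab, rfl, hc⟩ := h p hp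
      · refine ⟨x.1 + a, x.2 + b, ?_, by simp, ?_⟩
        · rw [List.map_cons, List.sum_cons, ← hab]; abel
        · intro hxc
          rw [Multiset.card_add, Multiset.card_add, hc fun y hy => hxc y (by simp [hy]),
            hxc x (by simp)]
      · refine ⟨x.2 + a, x.1 + b, ?_, by simp, ?_⟩
        · rw [List.map_cons, List.sum_cons, ← hab]; abel
        · intro hxc
          rw [Multiset.card_add, Multiset.card_add, hc fun y hy => hxc y (by simp [hy]),
            hxc x (by simp)]

theorem gain_color {P : Option (ZMod q)} {h : G} (hh : h ≠ 1) (hP : A.col h ≠ P) {S : Multiset G}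
    (hS : ∀ g ∈ S, g ≠ 1 ∧ A.col g = P) (hr : S.card + 1 ≤ r) : A.Gain (h ::ₘ S) S.card := by
  classical
  cases P with
  | none =>
    exact gain_insert_one (by rwa [Ne, ← col_eq_none])
      fun g hg => ⟨(hS g hg).1, col_eq_none.1 (hS g hg).2⟩
  | some f =>
    obtain ⟨l, rfl⟩ := Quot.exists_rep S
    change A.Gain (h ::ₘ (l : Multiset G)) (l : Multiset G).card
    replace hS : ∀ g ∈ l, g ≠ 1 ∧ A.col g = some f := fun g hg => hS g hg
    replace hr : l.length + 1 ≤ r := hr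
    obtain ⟨D, hD, hch⟩ := exists_choices (A := A)
      (l.map fun g => (({g} : Multiset G), (0 : Multiset G))) (by
        intro x hx
        obtain ⟨g, hg, rfl⟩ := List.mem_map.1 hx
        simpa using χ_ne_one_of_col (hS g hg).2)
    have hsum : ((l.map fun g => (({g} : Multiset G), (0 : Multiset G))).map
        fun x => x.1 + x.2).sum = (l : Multiset G) := by
      clear hS hr hD hch
      induction l with
      | nil => rfl
      | cons a l ih => simp_all [← Multiset.cons_coe]
    rw [hsum] at hch
    have hc := τ_sub_ne_zero hh hP
    have hsub : D.image (fun p : (ZMod q)ˣ => (f - A.χ h * A.χ l.prod * f) +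
        p * (A.τ h - f * (1 - A.χ h))) ⊆ A.vals (h ::ₘ (l : Multiset G)) := by
      intro y hy
      obtain ⟨p, hp, rfl⟩ := Finset.mem_image.1 hy
      obtain ⟨a, b, hab, rfl, -⟩ := hch p hp
      obtain ⟨la, rfl⟩ := Quot.exists_rep a
      obtain ⟨lb, rfl⟩ := Quot.exists_rep b
      change (la : Multiset G) + (lb : Multiset G) = l at hab
      change _ + (A.cls (la : Multiset G) : ZMod q) * _ ∈ _
      refine mem_vals.2 ⟨la ++ h :: lb, ?_, ?_⟩
      · rw [← hab, ← Multiset.coe_add, ← Multiset.cons_coe, Multiset.add_cons]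
      · have hmem : ∀ g, g ∈ la ∨ g ∈ lb → g ∈ l := by
          intro g hg
          have : g ∈ (l : Multiset G) := by rw [← hab]; simpa using hg
          exact this
        rw [List.prod_append, List.prod_cons, A.τ_mul, A.τ_mul, cls_coe,
          τ_list_prod fun g hg => τ_eq_of_col (hS g (hmem g (Or.inl hg))).2,
          τ_list_prod fun g hg => τ_eq_of_col (hS g (hmem g (Or.inr hg))).2]
        have hχ : A.χ l.prod = A.χ la.prod * A.χ lb.prod := by
          rw [← cls_coe, ← hab, cls_add, cls_coe, cls_coe]
        rw [hχ, Units.val_mul]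
        ring
    have hcard := Finset.card_le_card hsub
    rw [Finset.card_image_of_injective] at hcard
    · rw [List.length_map] at hD
      refine le_trans ?_ (hD.trans hcard)
      rw [Multiset.coe_card]
      omega
    · intro p p' hpp
      exact Units.ext (mul_right_cancel₀ hc (add_left_cancel hpp))

theorem gain_colors {P : Option (ZMod q)} {H S : Multiset G} (hH : ∀ h ∈ H, h ≠ 1 ∧ A.col h ≠ P)
    (hS : ∀ g ∈ S, g ≠ 1 ∧ A.col g = P) : A.Gain (H + S) (min S.card (H.card * (r - 1))) := by
  have hr : 0 < r := (Fact.out : r.Prime).pos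
  induction H using Multiset.induction_on generalizing S with
  | empty => simpa using gain_zero (A := A) S
  | cons h H ih =>
    obtain ⟨S₁, hle, hc⟩ := exists_le_card_eq (S := S)
      (min_le_left S.card (r - 1))
    obtain ⟨S₂, rfl⟩ := Multiset.le_iff_exists_add.1 hle
    have h1 := gain_color (A := A) (P := P) (hH h (by simp)).1 (hH h (by simp)).2
      (S := S₁) (fun g hg => hS g (by simp [hg])) (by omega)
    have h2 := ih (fun x hx => hH x (by simp [hx])) (S := S₂) (fun g hg => hS g (by simp [hg]))
    have h3 := h1.add h2
    have : h ::ₘ H + (S₁ + S₂) = h ::ₘ S₁ + (H + S₂) := by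
      rw [Multiset.cons_add, Multiset.cons_add]; congr 1; abel
    rw [this]
    refine h3.of_le ?_
    rw [Multiset.card_cons, add_mul, one_mul]
    rw [Multiset.card_add] at hc ⊢
    omega

end AffineData

theorem four_le_card_of_six {α : Type*} [DecidableEq α] {s : Finset α} {e₁ e₂ e₃ o₁ o₂ o₃ : α}
    (he₁ : e₁ ∈ s) (he₂ : e₂ ∈ s) (he₃ : e₃ ∈ s) (ho₁ : o₁ ∈ s) (ho₂ : o₂ ∈ s) (ho₃ : o₃ ∈ s)
    (h₁₂ : e₁ ≠ o₂) (h₁₃ : e₁ ≠ o₃) (h₂₁ : e₂ ≠ o₁) (h₂₃ : e₂ ≠ o₃) (h₃₁ : e₃ ≠ o₁)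
    (h₃₂ : e₃ ≠ o₂) (p₁₂ : ¬ (e₁ = e₂ ∧ o₁ = o₂)) (p₁₃ : ¬ (e₁ = e₃ ∧ o₁ = o₃))
    (p₂₃ : ¬ (e₂ = e₃ ∧ o₂ = o₃)) (n₁₂ : ¬ (e₁ = o₁ ∧ e₂ = o₂)) (n₁₃ : ¬ (e₁ = o₁ ∧ e₃ = o₃))
    (n₂₃ : ¬ (e₂ = o₂ ∧ e₃ = o₃)) : 4 ≤ s.card := by
  have four : ∀ a ∈ s, ∀ b ∈ s, ∀ c ∈ s, ∀ d ∈ s, a ≠ b → a ≠ c → a ≠ d → b ≠ c → b ≠ d →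
      c ≠ d → 4 ≤ s.card := by
    intro a ha b hb c hc d hd hab hac had hbc hbd hcd
    have hsub : ({a, b, c, d} : Finset α) ⊆ s := by
      intro x hx
      simp only [Finset.mem_insert, Finset.mem_singleton] at hx
      rcases hx with rfl | rfl | rfl | rfl <;> assumption
    have := Finset.card_le_card hsub
    rwa [Finset.card_insert_of_notMem (by simp [hab, hac, had]),
      Finset.card_insert_of_notMem (by simp [hbc, hbd]), Finset.card_pair hcd] at this
  by_cases q₁₂ : e₁ = e₂
  · by_cases q₁₃ : e₁ = e₃
    · subst q₁₂ q₁₃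
      exact four e₁ he₁ o₁ ho₁ o₂ ho₂ o₃ ho₃ (by tauto) (by tauto) (by tauto) (by tauto)
        (by tauto) (by tauto)
    · subst q₁₂
      exact four e₁ he₁ e₃ he₃ o₁ ho₁ o₂ ho₂ (by tauto) (by tauto) (by tauto) (by tauto)
        (by tauto) (by tauto)
  by_cases q₁₃ : e₁ = e₃
  · subst q₁₃
    exact four e₁ he₁ e₂ he₂ o₁ ho₁ o₃ ho₃ (by tauto) (by tauto) (by tauto) (by tauto)
      (by tauto) (by tauto)
  by_cases q₂₃ : e₂ = e₃
  · subst q₂₃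
    exact four e₁ he₁ e₂ he₂ o₂ ho₂ o₃ ho₃ (by tauto) (by tauto) (by tauto) (by tauto)
      (by tauto) (by tauto)
  by_cases q₁ : e₁ = o₁
  · refine four e₁ he₁ e₂ he₂ e₃ he₃ o₂ ho₂ (by tauto) (by tauto) (by tauto) (by tauto)
      (by tauto) (by tauto)
  · exact four e₁ he₁ e₂ he₂ e₃ he₃ o₁ ho₁ (by tauto) (by tauto) (by tauto) (by tauto)
      (by tauto) (by tauto)

namespace AffineData

variable {G : Type*} [Group G] {q r : ℕ} [Fact q.Prime] [Fact r.Prime] {A : AffineData G q r}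

theorem gain_of_bichromatic (hr3 : 3 ≤ r) (hrq : r < q) {a b c : G} (ha : a ≠ 1) (hb : b ≠ 1)
    (hc : c ≠ 1) (hab : A.col a ≠ A.col b) : A.Gain (c ::ₘ {a, b}) 2 := by
  by_cases hc1 : A.χ c = 1
  swap
  · exact (gain_pair ha hb hab).cons hc1 le_rfl hr3 hrq
  by_cases ha1 : A.χ a = 1
  · have hb1 : A.χ b ≠ 1 := fun h => hab (by rw [col_eq_none.2 ha1, col_eq_none.2 h])
    have := gain_insert_one (A := A) hb1 (X := {c, a}) (by
      intro x hx
      simp only [Multiset.insert_eq_cons, Multiset.mem_cons, Multiset.mem_singleton] at hx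
      rcases hx with rfl | rfl
      exacts [⟨hc, hc1⟩, ⟨ha, ha1⟩])
    rwa [Multiset.insert_eq_cons c, Multiset.cons_swap b c, ← Multiset.insert_eq_cons b,
      Multiset.pair_comm b a] at this
  by_cases hb1 : A.χ b = 1
  · have := gain_insert_one (A := A) ha1 (X := {c, b}) (by
      intro x hx
      simp only [Multiset.insert_eq_cons, Multiset.mem_cons, Multiset.mem_singleton] at hx
      rcases hx with rfl | rfl
      exacts [⟨hc, hc1⟩, ⟨hb, hb1⟩])
    rwa [Multiset.insert_eq_cons c, Multiset.cons_swap a c] at this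
  by_cases huv : A.χ a * A.χ b = 1
  swap
  · have := gain_insert_two ha1 hb1 huv (X := {c}) (by simpa using ⟨hc, hc1⟩)
    rwa [Multiset.card_singleton, mul_one, add_comm, Multiset.singleton_add] at this
  have hx := τ_ne_zero hc hc1
  have hs := τ_mul_ne_of_col_ne ha hb hab
  have huv' : (A.χ a : ZMod q) * A.χ b = 1 := by rw [← Units.val_mul, huv, Units.val_one]
  have hu := one_sub_ne_zero ha1
  have hv := one_sub_ne_zero hb1
  have perm : ∀ l : List G, l.Perm [c, a, b] → A.τ l.prod ∈ A.vals (c ::ₘ {a, b}) := fun l hl =>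
    mem_vals.2 ⟨l, Multiset.coe_eq_coe.2 hl, rfl⟩
  have m1 := perm [c, a, b] (List.Perm.refl _)
  have m2 := perm [a, c, b] (List.Perm.swap _ _ _)
  have m3 := perm [c, b, a] (by simp [List.Perm.swap])
  have m4 := perm [b, c, a] ((List.Perm.swap _ _ _).trans (by simp [List.Perm.swap]))
  simp only [List.prod_cons, List.prod_nil, mul_one, A.τ_mul, hc1, Units.val_one, one_mul]
    at m1 m2 m3 m4 hs
  refine (min_le_right _ _).trans (Finset.two_lt_card.2 ?_)
  by_contra! hcon
  have k1 := hcon _ m1 _ m2 _ m3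
  have n12 : A.τ c + (A.τ a + A.χ a * A.τ b) ≠ A.τ a + A.χ a * (A.τ c + A.τ b) := fun h =>
    mul_ne_zero hu hx (by linear_combination h)
  have n13 : A.τ c + (A.τ a + A.χ a * A.τ b) ≠ A.τ c + (A.τ b + A.χ b * A.τ a) := fun h =>
    hs (add_left_cancel h)
  have n34 : A.τ c + (A.τ b + A.χ b * A.τ a) ≠ A.τ b + A.χ b * (A.τ c + A.τ a) := fun h =>
    mul_ne_zero hv hx (by linear_combination h)
  have e23 := k1 n12 n13
  have e14 : A.τ c + (A.τ a + A.χ a * A.τ b) = A.τ b + A.χ b * (A.τ c + A.τ a) := by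
    by_contra h
    exact n34 (hcon _ m1 _ m3 _ m4 n13 h)
  have h3 : (1 - (A.χ a : ZMod q)) = A.χ b - 1 :=
    mul_right_cancel₀ hx (by linear_combination e14 - e23)
  have h4 : (1 - (A.χ a : ZMod q)) * (1 - A.χ a) = 0 := by
    linear_combination -(A.χ a : ZMod q) * h3 - huv'
  exact mul_ne_zero hu hu h4

theorem unit_ne_neg_one (hr3 : 3 ≤ r) (g : G) : (A.χ g : ZMod q) ≠ -1 ∨ q = 2 := by
  by_contra! h
  have h1 : (A.χ g : ZMod q) ^ r = 1 := by
    rw [← Units.val_pow_eq_pow_val, A.pow_eq_one, Units.val_one]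
  have hodd : Odd r := (Fact.out : r.Prime).odd_of_ne_two (by omega)
  rw [h.1, hodd.neg_one_pow] at h1
  have : ((2 : ℕ) : ZMod q) = 0 := by push_cast; linear_combination -h1
  rw [ZMod.natCast_eq_zero_iff] at this
  exact h.2 ((Nat.prime_dvd_prime_iff_eq Fact.out Nat.prime_two).1 this)

theorem gain_of_trichromatic (hr3 : 3 ≤ r) (hrq : r < q) {a b c : G} (ha : A.χ a ≠ 1)
    (hb : A.χ b ≠ 1) (hc : A.χ c ≠ 1) (hab : A.col a ≠ A.col b) (hac : A.col a ≠ A.col c)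
    (hbc : A.col b ≠ A.col c) : A.Gain {a, b, c} 3 := by
  classical
  have ne1 : ∀ g, A.χ g ≠ 1 → g ≠ 1 := by
    rintro g hg rfl
    simp at hg
  have dab := τ_mul_ne_of_col_ne (ne1 _ ha) (ne1 _ hb) hab
  have dbc := τ_mul_ne_of_col_ne (ne1 _ hb) (ne1 _ hc) hbc
  have dca := τ_mul_ne_of_col_ne (ne1 _ hc) (ne1 _ ha) hac.symm
  have na := (unit_ne_neg_one (A := A) hr3 a).resolve_right (by omega)
  have nb := (unit_ne_neg_one (A := A) hr3 b).resolve_right (by omega)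
  have nc := (unit_ne_neg_one (A := A) hr3 c).resolve_right (by omega)
  have ua := (A.χ a).ne_zero
  have ub := (A.χ b).ne_zero
  have uc := (A.χ c).ne_zero
  have ha' := one_sub_ne_zero ha
  have hb' := one_sub_ne_zero hb
  have hc' := one_sub_ne_zero hc
  have perm : ∀ l : List G, (l : Multiset G) = {a, b, c} → A.τ l.prod ∈ A.vals {a, b, c} :=
    fun l hl => mem_vals.2 ⟨l, hl, rfl⟩
  have e1 := perm [a, b, c] rfl
  have e2 := perm [b, c, a] (Multiset.coe_eq_coe.2 (List.perm_append_comm (l₁ := [b, c])))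
  have e3 := perm [c, a, b] (Multiset.coe_eq_coe.2 (List.perm_append_comm (l₁ := [c])))
  have o1 := perm [c, b, a] (Multiset.coe_eq_coe.2 (List.reverse_perm [a, b, c]))
  have o2 := perm [a, c, b] (Multiset.coe_eq_coe.2 (by simp [List.Perm.swap]))
  have o3 := perm [b, a, c] (Multiset.coe_eq_coe.2 (List.Perm.swap _ _ _))
  simp only [List.prod_cons, List.prod_nil, mul_one, A.τ_mul] at e1 e2 e3 o1 o2 o3 dab dbc dca
  rw [← sub_ne_zero] at dab dbc dca
  have npa : (1 + A.χ a : ZMod q) ≠ 0 := fun h => na (by linear_combination h)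
  have npb : (1 + A.χ b : ZMod q) ≠ 0 := fun h => nb (by linear_combination h)
  have npc : (1 + A.χ c : ZMod q) ≠ 0 := fun h => nc (by linear_combination h)
  refine (min_le_right _ _).trans (four_le_card_of_six e1 e2 e3 o1 o2 o3 ?_ ?_ ?_ ?_ ?_ ?_ ?_ ?_ ?_
    ?_ ?_ ?_)
  · exact fun h => mul_ne_zero ua dbc (by linear_combination h)
  · exact fun h => dab (by linear_combination h)
  · exact fun h => dbc (by linear_combination h)
  · exact fun h => mul_ne_zero ub dca (by linear_combination h)
  · exact fun h => mul_ne_zero uc dab (by linear_combination h)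
  · exact fun h => dca (by linear_combination h)
  · exact fun h => mul_ne_zero ha' dbc (by linear_combination -h.1 - h.2)
  · exact fun h => mul_ne_zero hc' dab (by linear_combination h.1 + h.2)
  · exact fun h => mul_ne_zero hb' dca (by linear_combination -h.1 - h.2)
  · exact fun h => mul_ne_zero npa dbc (by linear_combination h.1 + h.2)
  · exact fun h => mul_ne_zero npc dab (by linear_combination h.1 + h.2)
  · exact fun h => mul_ne_zero npb dca (by linear_combination h.1 + h.2)

theorem Gain.add_of_forall {T : Multiset G} {a : ℕ} (hT : A.Gain T a) (ha : 1 ≤ a) (hrq : r < q)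
    {E : Multiset G} (hE : ∀ g ∈ E, A.χ g ≠ 1) (har : a + E.card < r) :
    A.Gain (T + E) (a + E.card) := by
  induction E using Multiset.induction_on with
  | empty => simpa using hT
  | cons g E ih =>
    rw [Multiset.card_cons] at har ⊢
    rw [Multiset.add_cons, ← add_assoc]
    exact (ih (fun x hx => hE x (by simp [hx])) (by omega)).cons (hE g (by simp)) (by omega)
      (by omega) hrq

end AffineData

section
variable {ι : Type*} [DecidableEq ι]

theorem Multiset.sum_count_le_card (W : Multiset ι) (F : Finset ι) :
    ∑ c ∈ F, W.count c ≤ W.card := by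
  rw [← Multiset.sum_count_eq_card (s := F ∪ W.toFinset) (m := W) (by simp +contextual)]
  exact Finset.sum_le_sum_of_subset Finset.subset_union_left

theorem Multiset.exists_max_count {W : Multiset ι} (h : W ≠ 0) :
    ∃ c ∈ W, ∀ d, W.count d ≤ W.count c := by
  obtain ⟨c, hc, hmax⟩ := W.toFinset.exists_max_image W.count (Multiset.toFinset_nonempty.2 h)
  refine ⟨c, Multiset.mem_toFinset.1 hc, fun d => ?_⟩
  by_cases hd : d ∈ W
  · exact hmax d (Multiset.mem_toFinset.2 hd)
  · rw [Multiset.count_eq_zero.2 hd]; exact Nat.zero_le _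

theorem exists_bichromatic_pairs (s : ℕ) (W : Multiset ι) (h1 : ∀ c, s + W.count c ≤ W.card)
    (h2 : 2 * s ≤ W.card) :
    ∃ L : List (ι × ι), L.length = s ∧ (∀ x ∈ L, x.1 ≠ x.2) ∧
      (L.map fun x => ({x.1, x.2} : Multiset ι)).sum ≤ W := by
  induction s generalizing W with
  | zero => exact ⟨[], rfl, by simp, by simp⟩
  | succ s ih =>
    have hW : W ≠ 0 := by rintro rfl; simp at h2
    obtain ⟨c, hc, hmax⟩ := Multiset.exists_max_count hW
    obtain ⟨W₁, rfl⟩ := Multiset.exists_cons_of_mem hc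
    obtain ⟨d, hd, hcd⟩ : ∃ d ∈ W₁, d ≠ c := by
      by_contra! hall
      have h := h1 c
      rw [Multiset.count_cons_self, Multiset.card_cons,
        Multiset.count_eq_card.2 (fun x hx => (hall x hx).symm)] at h
      omega
    obtain ⟨W₂, rfl⟩ := Multiset.exists_cons_of_mem hd
    simp only [Multiset.card_cons, Multiset.count_cons] at h1 h2 hmax
    have h1' : ∀ e, s + W₂.count e ≤ W₂.card := by
      intro e
      have a1 := h1 e
      by_cases hec : e = c
      · subst hec
        rw [if_pos rfl, if_neg hcd.symm] at a1
        omega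
      by_cases hed : e = d
      · subst hed
        rw [if_pos rfl, if_neg hec] at a1
        omega
      have a2 := W₂.sum_count_le_card {e, c}
      rw [Finset.sum_pair hec] at a2
      have a3 := hmax e
      rw [if_neg hec, if_neg hed, if_pos trivial, if_neg hcd.symm] at a3
      omega
    obtain ⟨L, hL, hne, hle⟩ := ih W₂ h1' (by omega)
    refine ⟨(c, d) :: L, by simp [hL], ?_, ?_⟩
    · intro x hx
      rw [List.mem_cons] at hx
      rcases hx with rfl | hx
      exacts [hcd.symm, hne x hx]
    · rw [List.map_cons, List.sum_cons]
      calc _ ≤ ({c, d} : Multiset ι) + W₂ := by gcongr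
        _ = _ := by simp

theorem exists_trichromatic_triples (k : ℕ) (W : Multiset ι) (h0 : 3 * k ≤ W.card)
    (h1 : ∀ c, 2 * k + W.count c ≤ W.card)
    (h2 : ∀ c d, c ≠ d → k + W.count c + W.count d ≤ W.card) :
    ∃ L : List (ι × ι × ι), L.length = k ∧
      (∀ x ∈ L, x.1 ≠ x.2.1 ∧ x.1 ≠ x.2.2 ∧ x.2.1 ≠ x.2.2) ∧
      (L.map fun x => ({x.1, x.2.1, x.2.2} : Multiset ι)).sum ≤ W := by
  induction k generalizing W with
  | zero => exact ⟨[], rfl, by simp, by simp⟩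
  | succ k ih =>
    have hW : W ≠ 0 := by rintro rfl; simp at h0
    obtain ⟨a, ha, hmax⟩ := Multiset.exists_max_count hW
    obtain ⟨b, hb, hba, hmaxb⟩ : ∃ b ∈ W, b ≠ a ∧ ∀ d, d ≠ a → W.count d ≤ W.count b := by
      have hF : W.filter (· ≠ a) ≠ 0 := by
        intro h
        rw [Multiset.filter_eq_nil] at h
        have := h1 a
        rw [Multiset.count_eq_card.2 (fun x hx => (not_not.1 (h x hx)).symm)] at this
        omega
      obtain ⟨b, hb, hmaxb⟩ := Multiset.exists_max_count hF
      rw [Multiset.mem_filter] at hb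
      refine ⟨b, hb.1, hb.2, fun d hd => ?_⟩
      have := hmaxb d
      rwa [Multiset.count_filter_of_pos (p := fun x => x ≠ a) hd,
        Multiset.count_filter_of_pos (p := fun x => x ≠ a) hb.2] at this
    obtain ⟨c, hc, hca, hcb⟩ : ∃ c ∈ W, c ≠ a ∧ c ≠ b := by
      by_contra! hall
      have h3 := h2 a b hba.symm
      have h4 : W.card = W.count a + W.count b := by
        have := Multiset.sum_count_eq_card (s := {a, b}) (m := W) (by
          intro x hx
          by_cases hxa : x = a
          · simp [hxa]
          · simp [hall x hx hxa])
        rw [← this, Finset.sum_pair hba.symm]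
      omega
    obtain ⟨W₁, rfl⟩ := Multiset.exists_cons_of_mem ha
    rw [Multiset.mem_cons, or_iff_right hba] at hb
    obtain ⟨W₂, rfl⟩ := Multiset.exists_cons_of_mem hb
    rw [Multiset.mem_cons, or_iff_right hca, Multiset.mem_cons, or_iff_right hcb] at hc
    obtain ⟨W₃, rfl⟩ := Multiset.exists_cons_of_mem hc
    have hab := hba.symm
    have hac := hca.symm
    have hbc := hcb.symm
    set n := W₃.card with hn
    set f := fun e => W₃.count e with hf
    have ca : (a ::ₘ b ::ₘ c ::ₘ W₃).count a = f a + 1 := by simp [hab, hac, hf]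
    have cb : (a ::ₘ b ::ₘ c ::ₘ W₃).count b = f b + 1 := by simp [hba, hbc, hf]
    have cc : (a ::ₘ b ::ₘ c ::ₘ W₃).count c = f c + 1 := by simp [hca, hcb, hf]
    have co : ∀ e, e ≠ a → e ≠ b → e ≠ c → (a ::ₘ b ::ₘ c ::ₘ W₃).count e = f e := by
      intro e h h' h''; simp [h, h', h'', hf]
    have cn : (a ::ₘ b ::ₘ c ::ₘ W₃).card = n + 3 := by simp [hn]
    rw [cn] at h0 h1 h2
    rw [ca] at hmax
    rw [cb] at hmaxb
    have q4 : ∀ e, e ≠ a → e ≠ b → e ≠ c → f e + f a + f b + f c ≤ n := by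
      intro e h h' h''
      have := W₃.sum_count_le_card {e, a, b, c}
      rw [Finset.sum_insert (by simp [h, h', h'']), Finset.sum_insert (by simp [hab, hac]),
        Finset.sum_pair hbc] at this
      simp only [hf, hn]; omega
    have q5 : ∀ d e, d ≠ e → d ≠ a → d ≠ b → d ≠ c → e ≠ a → e ≠ b → e ≠ c →
        f d + f e + f a + f b + f c ≤ n := by
      intro d e hde g g' g'' h h' h''
      have := W₃.sum_count_le_card {d, e, a, b, c}
      rw [Finset.sum_insert (by simp [hde, g, g', g'']), Finset.sum_insert (by simp [h, h', h'']),
        Finset.sum_insert (by simp [hab, hac]), Finset.sum_pair hbc] at this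
      simp only [hf, hn]; omega
    have ia := h1 a
    have ib := h1 b
    have ic := h1 c
    have jab := h2 a b hab
    have jac := h2 a c hac
    have jbc := h2 b c hbc
    have mb := hmax b
    have mc := hmax c
    have mc' := hmaxb c hca
    rw [ca] at ia jab jac
    rw [cb] at ib jab jbc mb
    rw [cc] at ic jac jbc mc mc'
    have one : ∀ e, e ≠ a → e ≠ b → e ≠ c → f e ≤ f a + 1 ∧ f e ≤ f b + 1 ∧
        2 * (k + 1) + f e ≤ n + 3 ∧ (k + 1) + f a + 1 + f e ≤ n + 3 := by
      intro e h h' h''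
      have x1 := hmax e
      have x2 := hmaxb e h
      have x3 := h1 e
      have x4 := h2 a e h.symm
      rw [co e h h' h''] at x1 x2 x3 x4
      rw [ca] at x4
      omega
    have h1' : ∀ e, 2 * k + W₃.count e ≤ W₃.card := by
      intro e
      change 2 * k + f e ≤ n
      by_cases ea : e = a
      · subst ea; omega
      by_cases eb : e = b
      · subst eb; omega
      by_cases ec : e = c
      · subst ec; omega
      have := one e ea eb ec
      have := q4 e ea eb ec
      omega
    have h2' : ∀ d e, d ≠ e → k + W₃.count d + W₃.count e ≤ W₃.card := by
      have main : ∀ d e, d ≠ e → e ≠ a → e ≠ b → e ≠ c → k + f d + f e ≤ n := by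
        intro d e hde ea eb ec
        have s1 := one e ea eb ec
        have s2 := q4 e ea eb ec
        by_cases da : d = a
        · subst da; omega
        by_cases db : d = b
        · subst db; omega
        by_cases dc : d = c
        · subst dc; omega
        have s3 := one d da db dc
        have s4 := q5 d e hde da db dc ea eb ec
        omega
      intro d e hde
      change k + f d + f e ≤ n
      by_cases he : e = a ∨ e = b ∨ e = c
      · by_cases hd : d = a ∨ d = b ∨ d = c
        · rcases he with rfl | rfl | rfl <;> rcases hd with rfl | rfl | rfl <;>
            first | exact absurd rfl hde | omega
        · push Not at hd
          have := main e d hde.symm hd.1 hd.2.1 hd.2.2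
          omega
      · push Not at he
        exact main d e hde he.1 he.2.1 he.2.2
    obtain ⟨L, hL, hne, hle⟩ := ih W₃ (by omega) h1' h2'
    refine ⟨(a, b, c) :: L, by simp [hL], ?_, ?_⟩
    · intro x hx
      rw [List.mem_cons] at hx
      rcases hx with rfl | hx
      exacts [⟨hab, hac, hbc⟩, hne x hx]
    · rw [List.map_cons, List.sum_cons]
      calc _ ≤ ({a, b, c} : Multiset ι) + W₃ := by gcongr
        _ = _ := by simp

end

theorem exists_lift_pairs {G ι : Type*} (col : G → ι) (L : List (ι × ι)) (U : Multiset G)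
    (h : (L.map fun x => ({x.1, x.2} : Multiset ι)).sum ≤ U.map col) :
    ∃ L' : List (G × G), L'.map (fun x => (col x.1, col x.2)) = L ∧
      (L'.map fun x => ({x.1, x.2} : Multiset G)).sum ≤ U := by
  induction L generalizing U with
  | nil => exact ⟨[], rfl, by simp⟩
  | cons x L ih =>
    obtain ⟨R, hR⟩ := Multiset.le_iff_exists_add.1 h
    rw [List.map_cons, List.sum_cons, add_assoc] at hR
    obtain ⟨U₁, U₂, rfl, h₁, h₂⟩ := exists_add_of_map_eq_add _ _ _ _ hR
    obtain ⟨L', rfl, hL'⟩ := ih U₂ (h₂ ▸ Multiset.le_add_right _ _)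
    obtain ⟨l, rfl, hl⟩ := exists_list_of_coe_eq_map col [x.1, x.2] U₁ h₁.symm
    obtain ⟨a, _, rfl, ha, hl⟩ := List.map_eq_cons_iff.1 hl
    obtain ⟨b, _, rfl, hb, hl⟩ := List.map_eq_cons_iff.1 hl
    obtain rfl := List.map_eq_nil_iff.1 hl
    refine ⟨(a, b) :: L', by simp [ha, hb], ?_⟩
    rw [List.map_cons, List.sum_cons]
    exact add_le_add le_rfl hL'

theorem exists_lift_triples {G ι : Type*} (col : G → ι) (L : List (ι × ι × ι)) (U : Multiset G)
    (h : (L.map fun x => ({x.1, x.2.1, x.2.2} : Multiset ι)).sum ≤ U.map col) :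
    ∃ L' : List (G × G × G), L'.map (fun x => (col x.1, col x.2.1, col x.2.2)) = L ∧
      (L'.map fun x => ({x.1, x.2.1, x.2.2} : Multiset G)).sum ≤ U := by
  induction L generalizing U with
  | nil => exact ⟨[], rfl, by simp⟩
  | cons x L ih =>
    obtain ⟨R, hR⟩ := Multiset.le_iff_exists_add.1 h
    rw [List.map_cons, List.sum_cons, add_assoc] at hR
    obtain ⟨U₁, U₂, rfl, h₁, h₂⟩ := exists_add_of_map_eq_add _ _ _ _ hR
    obtain ⟨L', rfl, hL'⟩ := ih U₂ (h₂ ▸ Multiset.le_add_right _ _)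
    obtain ⟨l, rfl, hl⟩ := exists_list_of_coe_eq_map col [x.1, x.2.1, x.2.2] U₁ h₁.symm
    obtain ⟨a, _, rfl, ha, hl⟩ := List.map_eq_cons_iff.1 hl
    obtain ⟨b, _, rfl, hb, hl⟩ := List.map_eq_cons_iff.1 hl
    obtain ⟨c, _, rfl, hc, hl⟩ := List.map_eq_cons_iff.1 hl
    obtain rfl := List.map_eq_nil_iff.1 hl
    refine ⟨(a, b, c) :: L', by simp [ha, hb, hc], ?_⟩
    rw [List.map_cons, List.sum_cons]
    exact add_le_add le_rfl hL'

theorem ZMod.exists_add_eq_zero {q : ℕ} [NeZero q] {X Y : Finset (ZMod q)}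
    (h : q < X.card + Y.card) : ∃ x ∈ X, ∃ y ∈ Y, x + y = 0 := by
  classical
  by_contra! hne
  have hd : Disjoint X (Y.image fun y => -y) := by
    rw [Finset.disjoint_left]
    intro x hx hx'
    obtain ⟨y, hy, rfl⟩ := Finset.mem_image.1 hx'
    exact hne _ hx y hy (neg_add_cancel y)
  have h1 := Finset.card_union_of_disjoint hd
  rw [Finset.card_image_of_injective _ neg_injective] at h1
  have h2 := Finset.card_le_univ (X ∪ Y.image fun y => -y)
  rw [ZMod.card] at h2
  omega

namespace AffineData

variable {G : Type*} [Group G] {q r : ℕ} [Fact q.Prime] {A : AffineData G q r}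

theorem exists_cls_eq_one [Fact r.Prime] {S : Multiset G} (h : r ≤ S.card) :
    ∃ Z ≤ S, Z ≠ 0 ∧ A.cls Z = 1 := by
  classical
  have : NeZero r := ⟨(Fact.out : r.Prime).ne_zero⟩
  obtain ⟨l, rfl⟩ := Quot.exists_rep S
  replace h : r ≤ l.length := h
  let f : Fin (r + 1) → rootsOfUnity r (ZMod q) := fun i =>
    ⟨A.χ (l.take i).prod, by rw [mem_rootsOfUnity]; exact A.pow_eq_one _⟩
  obtain ⟨i, j, hij, he⟩ := Fintype.exists_ne_map_eq_of_card_lt f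
    (by
    rw [Fintype.card_fin, Fintype.card_eq_nat_card]
    exact Nat.lt_succ_of_le (card_rootsOfUnity (ZMod q) r))
  wlog hlt : i < j generalizing i j
  · exact this j i hij.symm he.symm (lt_of_le_of_ne (not_lt.1 hlt) hij.symm)
  have hlt' : (i : ℕ) < j := hlt
  have hj := j.2
  refine ⟨((l.take j).drop i : List G), ?_, ?_, ?_⟩
  · exact ((List.drop_sublist _ _).trans (List.take_sublist _ _)).subperm
  · intro h0
    have := congrArg Multiset.card h0
    rw [Multiset.coe_card, List.length_drop, List.length_take, Multiset.card_zero] at this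
    omega
  · rw [cls_coe]
    have h1 := congrArg List.prod (List.take_append_drop i (l.take j))
    rw [List.prod_append, List.take_take, min_eq_left hlt'.le] at h1
    have h2 := congrArg A.χ h1
    rw [map_mul, ← show A.χ (l.take i).prod = A.χ (l.take j).prod from congrArg Subtype.val he]
      at h2
    exact mul_eq_left.1 h2

theorem exists_null_of_col [Fact r.Prime] {f : ZMod q} {S : Multiset G}
    (hS : ∀ g ∈ S, A.col g = some f) (h : r ≤ S.card) :
    ∃ Z ≤ S, Z ≠ 0 ∧ IsProductOne Z := by
  obtain ⟨Z, hZ, h0, h1⟩ := exists_cls_eq_one (A := A) h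
  refine ⟨Z, hZ, h0, (isProductOne_iff (A := A)).2 ⟨h1, ?_⟩⟩
  obtain ⟨l, rfl⟩ := Quot.exists_rep Z
  refine mem_vals.2 ⟨l, rfl, ?_⟩
  rw [τ_list_prod (A := A) (f := f) fun g hg =>
    τ_eq_of_col (hS g (Multiset.mem_of_le hZ (Multiset.mem_coe.2 hg))), ← cls_coe]
  rw [show A.cls (l : Multiset G) = 1 from h1]
  simp

theorem exists_minimal_cls_eq_one {V : Multiset G} (h0 : V ≠ 0) (h1 : A.cls V = 1) :
    ∃ B ≤ V, B ≠ 0 ∧ A.cls B = 1 ∧ ∀ Z ≤ B, A.cls Z = 1 → Z = 0 ∨ Z = B := by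
  induction V using Multiset.strongInductionOn with
  | ih V ih =>
    by_cases h : ∀ Z ≤ V, A.cls Z = 1 → Z = 0 ∨ Z = V
    · exact ⟨V, le_rfl, h0, h1, h⟩
    · push Not at h
      obtain ⟨Z, hZ, hZ1, hZ0, hne⟩ := h
      obtain ⟨B, hB, h⟩ := ih Z (lt_of_le_of_ne hZ hne) hZ0 hZ1
      exact ⟨B, hB.trans hZ, h⟩

theorem card_le_card_vals_of_minimal {B : Multiset G} (h1 : A.cls B = 1)
    (hmin : ∀ Z ≤ B, A.cls Z = 1 → Z = 0 ∨ Z = B) (hB : ¬ IsProductOne B) :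
    B.card ≤ (A.vals B).card := by
  classical
  obtain ⟨l, rfl⟩ := Quot.exists_rep B
  change A.cls (l : Multiset G) = 1 at h1
  change ∀ Z ≤ (l : Multiset G), A.cls Z = 1 → Z = 0 ∨ Z = l at hmin
  change ¬ IsProductOne (l : Multiset G) at hB
  change l.length ≤ (A.vals (l : Multiset G)).card
  have hτ : A.τ l.prod ≠ 0 := fun h =>
    hB ((isProductOne_iff (A := A)).2 ⟨h1, mem_vals.2 ⟨l, rfl, h⟩⟩)
  rw [cls_coe] at h1
  have hsplit : ∀ i, (l.take i).prod * (l.drop i).prod = l.prod := fun i => by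
    rw [← List.prod_append, List.take_append_drop]
  rw [← Finset.card_range l.length]
  refine Finset.card_le_card_of_injOn (fun i => A.τ ((l.drop i).prod * (l.take i).prod)) ?_ ?_
  · intro i _
    refine mem_vals.2 ⟨l.drop i ++ l.take i, ?_, by rw [List.prod_append]⟩
    rw [← Multiset.coe_add, add_comm, Multiset.coe_add, List.take_append_drop]
  · intro i hi j hj hij
    have hconj : ∀ i, A.τ ((l.drop i).prod * (l.take i).prod) =
        ((A.χ (l.take i).prod)⁻¹ : (ZMod q)ˣ) * A.τ l.prod := fun i => by
      rw [A.τ_conj_of_mul (by rw [hsplit, h1]), hsplit]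
    simp only [hconj] at hij
    have he : A.χ (l.take i).prod = A.χ (l.take j).prod :=
      inv_injective (Units.ext (mul_right_cancel₀ hτ hij))
    by_contra hne
    wlog hlt : i < j generalizing i j
    · exact this hj hi hij.symm he.symm (Ne.symm hne) (lt_of_le_of_ne (not_lt.1 hlt) (Ne.symm hne))
    have hj' : j < l.length := by simpa using hj
    have h2 := congrArg List.prod (List.take_append_drop i (l.take j))
    rw [List.prod_append, List.take_take, min_eq_left hlt.le] at h2
    have h3 := congrArg A.χ h2
    rw [map_mul, ← he] at h3
    have h4 := hmin ((l.take j).drop i : List G)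
      ((List.drop_sublist _ _).trans (List.take_sublist _ _)).subperm
      (by rw [cls_coe]; exact mul_eq_left.1 h3)
    have hlen : ((l.take j).drop i).length = j - i := by
      rw [List.length_drop, List.length_take]; omega
    rcases h4 with h | h
    · have := congrArg Multiset.card h
      rw [Multiset.coe_card, hlen, Multiset.card_zero] at this
      omega
    · have := congrArg Multiset.card h
      rw [Multiset.coe_card, hlen, Multiset.coe_card] at this
      omega

open Classical in
variable (A) in
/-- The translation parts of the products of class one of subsequences of `V`. -/
noncomputable def subVals (V : Multiset G) : Finset (ZMod q) :=
  Finset.univ.filter fun v => ∃ l : List G, (l : Multiset G) ≤ V ∧ A.χ l.prod = 1 ∧ A.τ l.prod = v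

theorem mem_subVals {V : Multiset G} {v : ZMod q} :
    v ∈ A.subVals V ↔ ∃ l : List G, (l : Multiset G) ≤ V ∧ A.χ l.prod = 1 ∧ A.τ l.prod = v := by
  simp [subVals]

open Pointwise in
theorem min_le_card_subVals {V : Multiset G} (h1 : A.cls V = 1)
    (hV : ∀ Z ≤ V, IsProductOne Z → Z = 0) : min q (V.card + 1) ≤ (A.subVals V).card := by
  classical
  induction V using Multiset.strongInductionOn with
  | ih V ih =>
    have hne : ∀ V : Multiset G, 0 ∈ A.subVals V := fun V =>
      mem_subVals.2 ⟨[], by simp, by simp, by simp [τ_one]⟩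
    by_cases h0 : V = 0
    · subst h0
      exact (min_le_right _ _).trans (Finset.card_pos.2 ⟨_, hne 0⟩)
    obtain ⟨B, hB, hB0, hB1, hmin⟩ := exists_minimal_cls_eq_one h0 h1
    obtain ⟨V', rfl⟩ := Multiset.le_iff_exists_add.1 hB
    have hBp : ¬ IsProductOne B := fun h => hB0 (hV B hB h)
    have hcB := card_le_card_vals_of_minimal hB1 hmin hBp
    have hV'1 : A.cls V' = 1 := by rwa [cls_add, hB1, one_mul] at h1
    have hlt : V' < B + V' := lt_add_of_pos_left _ (pos_iff_ne_zero.2 hB0)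
    have hI := ih V' hlt hV'1 fun Z hZ => hV Z (hZ.trans hlt.le)
    have h0B : (0 : ZMod q) ∉ A.vals B := fun h =>
      hBp ((isProductOne_iff (A := A)).2 ⟨hB1, h⟩)
    have hcd := ZMod.cauchy_davenport (p := q) Fact.out ⟨0, hne V'⟩
      (Finset.insert_nonempty (0 : ZMod q) (A.vals B))
    rw [Finset.card_insert_of_notMem h0B] at hcd
    have hsub : A.subVals V' + insert 0 (A.vals B) ⊆ A.subVals (B + V') := by
      intro x hx
      obtain ⟨v, hv, w, hw, rfl⟩ := Finset.mem_add.1 hx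
      obtain ⟨l, hl, hl1, rfl⟩ := mem_subVals.1 hv
      rcases Finset.mem_insert.1 hw with rfl | hw
      · exact mem_subVals.2 ⟨l, hl.trans hlt.le, hl1, by simp⟩
      · obtain ⟨m, rfl, rfl⟩ := mem_vals.1 hw
        rw [cls_coe] at hB1
        refine mem_subVals.2 ⟨l ++ m, ?_, by simp [hl1, hB1], by
          rw [List.prod_append, A.τ_mul, hl1]; simp⟩
        rw [← Multiset.coe_add, add_comm]
        exact add_le_add_right hl _
    have := hcd.trans (Finset.card_le_card hsub)
    rw [Multiset.card_add]
    omega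

theorem exists_null_of_cls_eq_one {V : Multiset G} (h1 : A.cls V = 1) (hq : q ≤ V.card) :
    ∃ Z ≤ V, Z ≠ 0 ∧ IsProductOne Z := by
  by_contra! hno
  have hV : ∀ Z ≤ V, IsProductOne Z → Z = 0 := fun Z hZ hp => by
    by_contra h0; exact hno Z hZ h0 hp
  have hqp : 0 < q := (Fact.out : q.Prime).pos
  have h0 : V ≠ 0 := by rintro rfl; simp at hq; omega
  obtain ⟨B, hB, hB0, hB1, hmin⟩ := exists_minimal_cls_eq_one h0 h1
  obtain ⟨V', rfl⟩ := Multiset.le_iff_exists_add.1 hB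
  have hBp : ¬ IsProductOne B := fun h => hB0 (hV B hB h)
  have hcB := card_le_card_vals_of_minimal hB1 hmin hBp
  have hV'1 : A.cls V' = 1 := by rwa [cls_add, hB1, one_mul] at h1
  have hI := min_le_card_subVals hV'1 fun Z hZ =>
    hV Z (hZ.trans (Multiset.le_add_left _ _))
  have hBpos := Multiset.card_pos.2 hB0
  rw [Multiset.card_add] at hq
  obtain ⟨x, hx, y, hy, hxy⟩ := ZMod.exists_add_eq_zero (X := A.subVals V') (Y := A.vals B)
    (by omega)
  obtain ⟨l, hl, hl1, rfl⟩ := mem_subVals.1 hx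
  obtain ⟨m, rfl, rfl⟩ := mem_vals.1 hy
  rw [cls_coe] at hB1
  refine hno (l ++ m : List G) ?_ ?_ (isProductOne_coe (A.eq_one _ (by simp [hl1, hB1]) ?_))
  · rw [← Multiset.coe_add, add_comm]
    exact add_le_add_right hl _
  · rw [← Multiset.coe_add]
    exact fun h => hB0 (add_eq_zero.1 h).2
  · rw [List.prod_append, A.τ_mul, hl1]
    simpa using hxy

theorem exists_null [Fact r.Prime] (A : AffineData G q r) {R : Multiset G} (hR : q + r ≤ R.card + 1) :
    ∃ Z ≤ R, Z ≠ 0 ∧ IsProductOne Z := by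
  suffices h : ∃ V ≤ R, A.cls V = 1 ∧ R.card < V.card + r by
    obtain ⟨V, hV, h1, hc⟩ := h
    obtain ⟨Z, hZ, h⟩ := exists_null_of_cls_eq_one h1 (by omega)
    exact ⟨Z, hZ.trans hV, h⟩
  clear hR
  induction R using Multiset.strongInductionOn with
  | ih R ih =>
    by_cases hr : R.card < r
    · exact ⟨0, Multiset.zero_le _, cls_zero _, by simpa using hr⟩
    obtain ⟨Z, hZ, h0, h1⟩ := exists_cls_eq_one (A := A) (not_lt.1 hr)
    obtain ⟨R', rfl⟩ := Multiset.le_iff_exists_add.1 hZ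
    obtain ⟨V, hV, hV1, hc⟩ := ih R' (lt_add_of_pos_left _ (pos_iff_ne_zero.2 h0))
    refine ⟨Z + V, add_le_add_right hV _, by simp [h1, hV1], ?_⟩
    simp only [Multiset.card_add]
    omega

end AffineData

theorem Multiset.exists_finset_le {G : Type*} [DecidableEq G] {Y : Multiset G} {h : ℕ} (hc : ∀ x, Y.count x ≤ h + 1)
    (hY : h + 1 ≤ Y.card) :
    ∃ F : Finset G, F.Nonempty ∧ F.val ≤ Y ∧ F.card + h ≤ Y.card ∧
      ∀ x, (Y - F.val).count x ≤ h := by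
  by_cases hF : (Y.toFinset.filter fun x => Y.count x = h + 1).Nonempty
  · set F := Y.toFinset.filter fun x => Y.count x = h + 1 with hFdef
    have hmem : ∀ x, x ∈ F ↔ Y.count x = h + 1 := by
      intro x
      rw [hFdef, Finset.mem_filter, Multiset.mem_toFinset, and_iff_right_iff_imp]
      intro hx
      rw [← Multiset.count_pos]; omega
    have hle : F.val ≤ Y := by
      rw [Finset.val_le_iff_val_subset]
      intro x hx
      have := (hmem x).1 hx
      rw [← Multiset.count_pos]; omega
    have hsum : F.card * (h + 1) ≤ Y.card := by
      have := Y.sum_count_le_card F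
      rwa [Finset.sum_congr rfl fun x hx => (hmem x).1 hx, Finset.sum_const, smul_eq_mul] at this
    have hpos := Finset.card_pos.2 hF
    refine ⟨F, hF, hle, by nlinarith, fun x => ?_⟩
    rw [Multiset.count_sub]
    by_cases hx : x ∈ F
    · have h1 := hc x
      have h2 : 0 < F.val.count x := Multiset.count_pos.2 hx
      omega
    · have h1 := hc x
      have h2 := mt (hmem x).2 hx
      omega
  · obtain ⟨x, hx⟩ := Multiset.card_pos_iff_exists_mem.1 (by omega : 0 < Y.card)
    refine ⟨{x}, by simp, by simpa using hx, by simp; omega, fun y => ?_⟩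
    rw [Finset.not_nonempty_iff_eq_empty, Finset.filter_eq_empty_iff] at hF
    have h1 := hc y
    have h2 : Y.count y ≠ h + 1 := by
      intro h2
      exact hF (Multiset.mem_toFinset.2 (Multiset.count_pos.1 (by omega))) h2
    exact (Multiset.count_le_of_le _ (Multiset.sub_le_self _ _)).trans (by omega)

namespace AffineData

variable {G : Type*} [Group G] {q r : ℕ} [Fact q.Prime] {A : AffineData G q r}

open Classical in
variable (A) in
/-- The translation parts of the products of `n` terms of `Y`. -/
noncomputable def lenVals (n : ℕ) (Y : Multiset G) : Finset (ZMod q) :=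
  Finset.univ.filter fun v => ∃ l : List G, (l : Multiset G) ≤ Y ∧ l.length = n ∧ A.τ l.prod = v

theorem mem_lenVals {n : ℕ} {Y : Multiset G} {v : ZMod q} :
    v ∈ A.lenVals n Y ↔
      ∃ l : List G, (l : Multiset G) ≤ Y ∧ l.length = n ∧ A.τ l.prod = v := by
  simp [lenVals]

open Pointwise in
theorem min_le_card_lenVals [DecidableEq G] {e : (ZMod q)ˣ} {n k : ℕ} {Y : Multiset G}
    (hY : ∀ g ∈ Y, A.χ g = e) (hc : ∀ x, Y.count x ≤ n) (hk : n + k ≤ Y.card) :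
    min q (k + 1) ≤ (A.lenVals n Y).card := by
  induction n generalizing k Y with
  | zero =>
    have h0 : Y = 0 := by
      rw [← Multiset.toFinset_eq_empty, Finset.eq_empty_iff_forall_notMem]
      intro x hx
      have := Multiset.count_pos.2 (Multiset.mem_toFinset.1 hx)
      have := hc x
      omega
    subst h0
    have hk0 : k = 0 := by simpa using hk
    subst hk0
    exact (min_le_right _ _).trans (Finset.card_pos.2 ⟨_, mem_lenVals.2 ⟨[], by simp, rfl, rfl⟩⟩)
  | succ n ih =>
    obtain ⟨F, hF0, hF, hcard, hcount⟩ := Multiset.exists_finset_le hc (by omega)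
    have hsplit : F.val + (Y - F.val) = Y := add_tsub_cancel_of_le hF
    have hlen : F.card + (Y - F.val).card = Y.card := by
      rw [← hsplit, Multiset.card_add]; simp
    have hI := ih (k := (Y - F.val).card - n) (Y := Y - F.val)
      (fun g hg => hY g (Multiset.mem_of_le (Multiset.sub_le_self _ _) hg)) hcount (by omega)
    have hq : 0 < q := (Fact.out : q.Prime).pos
    have hFi : (F.image A.τ).card = F.card := by
      refine Finset.card_image_of_injOn fun x hx y hy hxy => A.ext_of_eq ?_ hxy
      rw [hY x (Multiset.mem_of_le hF hx), hY y (Multiset.mem_of_le hF hy)]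
    have hcd := ZMod.cauchy_davenport (p := q) Fact.out (hF0.image A.τ)
      ((Finset.card_pos.1 (by omega : 0 < (A.lenVals n (Y - F.val)).card)).image
        fun x => 0 + (e : ZMod q) * x)
    rw [hFi, card_image_add_unit_mul] at hcd
    have hsub : F.image A.τ + (A.lenVals n (Y - F.val)).image (fun x => 0 + (e : ZMod q) * x) ⊆
        A.lenVals (n + 1) Y := by
      intro x hx
      obtain ⟨v, hv, w, hw, rfl⟩ := Finset.mem_add.1 hx
      obtain ⟨g, hg, rfl⟩ := Finset.mem_image.1 hv
      obtain ⟨w', hw', rfl⟩ := Finset.mem_image.1 hw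
      obtain ⟨l, hl, hln, rfl⟩ := mem_lenVals.1 hw'
      refine mem_lenVals.2 ⟨g :: l, ?_, by simp [hln], ?_⟩
      · rw [← hsplit, ← Multiset.cons_coe, ← Multiset.singleton_add]
        exact add_le_add (Multiset.singleton_le.2 hg) hl
      · rw [List.prod_cons, A.τ_mul, hY g (Multiset.mem_of_le hF hg), zero_add]
    have := hcd.trans (Finset.card_le_card hsub)
    have := Finset.card_pos.2 hF0
    omega

theorem exists_null_of_χ_eq [DecidableEq G] {e : (ZMod q)ˣ} (he : e ^ r = 1) {Y : Multiset G}
    (hY : ∀ g ∈ Y, A.χ g = e) (hc : ∀ x, Y.count x ≤ r) (hk : q + r ≤ Y.card + 1) :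
    ∃ Z ≤ Y, Z.card = r ∧ IsProductOne Z := by
  have hq : 0 < q := (Fact.out : q.Prime).pos
  have h := min_le_card_lenVals (k := q - 1) hY hc (by omega)
  have huniv : A.lenVals r Y = Finset.univ := by
    rw [← Finset.card_eq_iff_eq_univ, ZMod.card]
    have := (Finset.card_le_univ (A.lenVals r Y)).trans_eq (ZMod.card q)
    omega
  obtain ⟨l, hl, hlen, hτ⟩ := mem_lenVals.1 (huniv ▸ Finset.mem_univ (0 : ZMod q))
  refine ⟨l, hl, by simpa using hlen, isProductOne_coe (A.eq_one _ ?_ hτ)⟩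
  rw [map_list_prod, List.prod_eq_pow_card _ e, List.length_map, hlen, he]
  simp only [List.mem_map]
  rintro _ ⟨g, hg, rfl⟩
  exact hY g (Multiset.mem_of_le hl hg)

variable [Fact r.Prime]

theorem gain_triples (hrq : r < q) (L : List (G × G × G))
    (hL : ∀ x ∈ L, A.Gain {x.1, x.2.1, x.2.2} 3) {E : Multiset G} (hE : ∀ g ∈ E, A.χ g ≠ 1)
    (hc : E.card ≤ L.length * (r - 4)) :
    A.Gain ((L.map fun x => ({x.1, x.2.1, x.2.2} : Multiset G)).sum + E)
      (3 * L.length + E.card) := by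
  induction L generalizing E with
  | nil =>
    have : E = 0 := by simpa using hc
    subst this
    exact gain_zero _
  | cons x L ih =>
    obtain ⟨E₁, hE₁, hc₁⟩ := exists_le_card_eq (S := E) (n := min E.card (r - 4)) (min_le_left _ _)
    obtain ⟨E₂, rfl⟩ := Multiset.le_iff_exists_add.1 hE₁
    rw [List.length_cons, add_mul, one_mul] at hc
    rw [Multiset.card_add] at hc hc₁
    have h1 := ih (fun y hy => hL y (List.mem_cons_of_mem _ hy)) (E := E₂)
      (fun g hg => hE g (Multiset.mem_add.2 (Or.inr hg))) (by omega)
    have hx := hL x (by simp)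
    have h2 : A.Gain ({x.1, x.2.1, x.2.2} + E₁) (3 + E₁.card) := by
      by_cases h0 : E₁ = 0
      · subst h0; simpa using hx
      · have := Multiset.card_pos.2 h0
        exact hx.add_of_forall (by norm_num) hrq
          (fun g hg => hE g (Multiset.mem_add.2 (Or.inl hg))) (by omega)
    have h3 := h2.add h1
    rw [List.map_cons, List.sum_cons, List.length_cons, Multiset.card_add,
      add_add_add_comm]
    convert h3 using 1
    omega

theorem gain_of_count_col_le [DecidableEq G] {κ : ℕ} (hκ : 1 ≤ κ) (hr3 : 3 ≤ r)
    (hq : q = 2 * κ * r + 1) {U : Multiset G} (hU : ∀ g ∈ U, A.χ g ≠ 1) (hcard : q + 1 ≤ U.card)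
    (hc : ∀ c, (U.map A.col).count c + 1 ≤ r) : A.Gain U (q - 1) := by
  have hrq : r < q := by nlinarith
  have hodd : Odd r := (Fact.out : r.Prime).odd_of_ne_two (by omega)
  have key : ∀ k e : ℕ, 3 * k ≤ U.card → 2 * k + (r - 1) ≤ U.card → k + 2 * (r - 1) ≤ U.card →
      3 * k + e ≤ U.card → e ≤ k * (r - 4) → A.Gain U (3 * k + e) := by
    intro k e h0 h1 h2 h3 he
    obtain ⟨L, hL, hne, hle⟩ := exists_trichromatic_triples k (U.map A.col) (by simpa using h0)
      (fun c => by have := hc c; rw [Multiset.card_map]; omega)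
      (fun c d _ => by have := hc c; have := hc d; rw [Multiset.card_map]; omega)
    obtain ⟨L', rfl, hle'⟩ := exists_lift_triples A.col L U hle
    rw [List.length_map] at hL
    obtain ⟨R, hR⟩ := Multiset.le_iff_exists_add.1 hle'
    have hcardT : (L'.map fun x => ({x.1, x.2.1, x.2.2} : Multiset G)).sum.card = 3 * k := by
      rw [← hL]
      clear * -
      induction L' with
      | nil => simp
      | cons x L ih =>
        rw [List.map_cons, List.sum_cons, Multiset.card_add, ih]
        simp only [Multiset.insert_eq_cons, Multiset.card_cons, Multiset.card_singleton,
          List.length_cons]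
        ring
    have hcR := congrArg Multiset.card hR
    rw [Multiset.card_add, hcardT] at hcR
    obtain ⟨E, hE, hEc⟩ := exists_le_card_eq (S := R) (n := e) (by omega)
    have hUm : ∀ x ∈ L', ∀ g ∈ ({x.1, x.2.1, x.2.2} : Multiset G), g ∈ U := fun x hx g hg =>
      Multiset.mem_of_le hle' (Multiset.mem_of_le
        (List.single_le_sum (by simp) _ (List.mem_map_of_mem (f := fun x : G × G × G =>
          ({x.1, x.2.1, x.2.2} : Multiset G)) hx)) hg)
    have hg := gain_triples (A := A) hrq L' (fun x hx => ?_) (E := E)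
      (fun g hg => hU g (hR ▸ Multiset.mem_add.2 (Or.inr (Multiset.mem_of_le hE hg))))
      (by rw [hL, hEc]; exact he)
    · rw [hL, hEc] at hg
      refine hg.mono ?_
      rw [hR]
      exact add_le_add_right hE _
    · have h := hne _ (List.mem_map_of_mem hx)
      exact gain_of_trichromatic hr3 hrq (hU _ (hUm x hx _ (by simp)))
        (hU _ (hUm x hx _ (by simp))) (hU _ (hUm x hx _ (by simp))) h.1 h.2.1 h.2.2
  by_cases h3 : r = 3
  · have := key (2 * κ) 0 (by subst h3; omega) (by subst h3; omega) (by subst h3; omega)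
      (by subst h3; omega) (by simp)
    convert this using 1
    subst h3; omega
  · have h5 : 5 ≤ r := by
      obtain ⟨s, hs⟩ := hodd
      omega
    obtain ⟨r', rfl⟩ := Nat.exists_eq_add_of_le h5
    obtain ⟨k', rfl⟩ := Nat.exists_eq_add_of_le hκ
    have hexp : q = 2 * k' * r' + 10 * k' + 2 * r' + 11 := by rw [hq]; ring
    have h1 : 5 + r' - 1 = 4 + r' := by omega
    have h2 : 5 + r' - 4 = 1 + r' := by omega
    have h3 : (1 + k') * (1 + r') = 1 + k' + r' + k' * r' := by ring
    have h4 : 3 * (1 + k') * (1 + r') = 3 * (1 + k' + r' + k' * r') := by ring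
    have h5 : 2 * k' * r' = 2 * (k' * r') := by ring
    have := key (3 * (1 + k')) (2 * (k' * r') + k' + 2 * r' + 1) (by omega) (by rw [h1]; omega)
      (by rw [h1]; omega) (by omega) (by rw [h2, h4]; omega)
    convert this using 1
    omega

end AffineData

theorem IsMinimalProductOne.one_notMem {G : Type*} [Group G] {S : Multiset G}
    (hS : IsMinimalProductOne S) (hn : 2 ≤ S.card) : (1 : G) ∉ S := by
  intro h1
  obtain ⟨l, rfl, hl⟩ := hS.2.1
  obtain ⟨l₁, l₂, rfl⟩ := List.append_of_mem (Multiset.mem_coe.1 h1)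
  have h2 : (l₁ ++ l₂).prod = 1 := by simpa using hl
  have h3 : ((l₁ ++ 1 :: l₂ : List G) : Multiset G) = {1} + (l₁ ++ l₂ : List G) := by
    rw [← Multiset.coe_add, ← Multiset.cons_coe, Multiset.add_cons, Multiset.coe_add,
      Multiset.singleton_add]
  rcases hS.eq_zero_or_eq_zero h3 ⟨[1], rfl, by simp⟩ (isProductOne_coe h2) with h | h
  · simp at h
  · rw [h3, h] at hn
    simp at hn

theorem Multiset.exists_add_card_eq {α : Type*} {S : Multiset α} {n : ℕ} (h : n ≤ S.card) :
    ∃ T U, S = T + U ∧ T.card = n := by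
  obtain ⟨T, hT, hc⟩ := exists_le_card_eq h
  obtain ⟨U, rfl⟩ := Multiset.le_iff_exists_add.1 hT
  exact ⟨T, U, rfl, hc⟩

theorem eq_one_of_pow_eq_one_of_mul_self {M : Type*} [Monoid M] {r : ℕ} (hr : Odd r) {u : M}
    (h1 : u ^ r = 1) (h2 : u * u = 1) : u = 1 := by
  obtain ⟨s, rfl⟩ := hr
  rwa [pow_succ, pow_mul, sq, h2, one_pow, one_mul] at h1

theorem exists_pair_mul_ne_one {G M : Type*} [Group M] {r : ℕ} (hr : Odd r) {χ : G → M}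
    (hχ : ∀ g, χ g ^ r = 1) {O : Multiset G} (hO : ∀ g ∈ O, χ g ≠ 1) (hc : 3 ≤ O.card) :
    ∃ a b O', O = {a, b} + O' ∧ χ a * χ b ≠ 1 := by
  obtain ⟨T, O', rfl, hT⟩ := Multiset.exists_add_card_eq hc
  obtain ⟨a, b, c, rfl⟩ := Multiset.card_eq_three.1 hT
  by_cases hab : χ a * χ b = 1
  · by_cases hac : χ a * χ c = 1
    · refine ⟨b, c, a ::ₘ O', ?_, fun hbc => ?_⟩
      · simp only [Multiset.insert_eq_cons, Multiset.cons_add, Multiset.singleton_add]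
        rw [Multiset.cons_swap, Multiset.cons_swap a c]
      · have h1 := mul_left_cancel (hab.trans hac.symm)
        refine hO b (by simp) (eq_one_of_pow_eq_one_of_mul_self hr (hχ b) ?_)
        rw [← h1] at hbc
        exact hbc
    · refine ⟨a, c, b ::ₘ O', ?_, hac⟩
      simp only [Multiset.insert_eq_cons, Multiset.cons_add, Multiset.singleton_add]
      rw [Multiset.cons_swap b c]
  · refine ⟨a, b, c ::ₘ O', ?_, hab⟩
    simp only [Multiset.insert_eq_cons, Multiset.cons_add, Multiset.singleton_add]

namespace AffineData

variable {G : Type*} [Group G] {q r : ℕ} [Fact q.Prime] {A : AffineData G q r}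

theorem card_le_of_translations {S : Multiset G} (hS : IsMinimalProductOne S)
    (h : ∀ g ∈ S, A.χ g = 1) : S.card ≤ q := by
  obtain ⟨l, rfl, hl⟩ := hS.2.1
  have hχ : ∀ i, A.χ (l.take i).prod = 1 := by
    intro i
    rw [← cls_coe]
    exact cls_eq_one_of_forall _ fun g hg =>
      h g (Multiset.mem_coe.2 (List.mem_of_mem_take (Multiset.mem_coe.1 hg)))
  have := Finset.card_le_card_of_injOn (s := Finset.range l.length) (t := Finset.univ)
    (fun i => A.τ (l.take i).prod) (fun _ _ => Finset.mem_univ _) ?_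
  · rwa [Finset.card_range, Finset.card_univ, ZMod.card] at this
  · intro i hi j hj hij
    have he := A.ext_of_eq ((hχ i).trans (hχ j).symm) hij
    simp only [Finset.coe_range, Set.mem_Iio] at hi hj
    rcases lt_trichotomy i j with hlt | rfl | hlt
    · exact absurd he (hS.take_prod_ne hl hlt hj)
    · rfl
    · exact absurd he.symm (hS.take_prod_ne hl hlt hi)

theorem exists_card_le_of_prefix (f : ZMod q) (l : List G) [DecidableEq (Option (ZMod q))] :
    ∃ F : Finset (ZMod q), F.card ≤ (l.filter (A.col · ≠ some f)).length + 1 ∧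
      ∀ p, p <+: l → A.τ p.prod + A.χ p.prod * f ∈ F := by
  induction l using List.reverseRecOn with
  | nil => exact ⟨{f}, by simp, by simp [τ_one]⟩
  | append_singleton l g ih =>
    obtain ⟨F, hF, h⟩ := ih
    by_cases hg : A.col g = some f
    · refine ⟨F, by simpa [List.filter_append, hg] using hF, fun p hp => ?_⟩
      rcases List.prefix_concat_iff.1 hp with rfl | hp
      · convert h l (List.prefix_refl l) using 1
        rw [List.prod_append, List.prod_singleton, A.τ_mul, τ_eq_of_col hg, map_mul,
          Units.val_mul]
        ring
      · exact h p hp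
    · refine ⟨insert (A.τ (l ++ [g]).prod + A.χ (l ++ [g]).prod * f) F, ?_, fun p hp => ?_⟩
      · have h1 := Finset.card_insert_le (A.τ (l ++ [g]).prod + A.χ (l ++ [g]).prod * f) F
        have h2 : (l ++ [g]).filter (A.col · ≠ some f) =
            l.filter (A.col · ≠ some f) ++ [g] := by simp [List.filter_append, hg]
        rw [h2, List.length_append, List.length_singleton]
        omega
      · rcases List.prefix_concat_iff.1 hp with rfl | hp
        · exact Finset.mem_insert_self _ _
        · exact Finset.mem_insert_of_mem (h p hp)

variable [Fact r.Prime]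

theorem false_of_many_translations (hr3 : 3 ≤ r) {K : ℕ} (hq : q = 2 * K + 1) (hrK : r ≤ K)
    {N O : Multiset G} (hS : IsMinimalProductOne (N + O)) (h1 : ∀ g ∈ N, g ≠ 1)
    (hN : ∀ g ∈ N, A.χ g = 1) (hO : ∀ g ∈ O, A.χ g ≠ 1) (hn : 2 * q + 1 ≤ N.card + O.card)
    (ht : K ≤ N.card) : False := by
  by_cases m0 : O.card = 0
  · rw [Multiset.card_eq_zero] at m0
    subst m0
    rw [add_zero] at hS
    have := card_le_of_translations hS hN
    simp at hn
    omega
  by_cases m1 : O.card = 1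
  · obtain ⟨g, rfl⟩ := Multiset.card_eq_one.1 m1
    have := ((isProductOne_iff (A := A)).1 hS.2.1).1
    rw [cls_add, cls_eq_one_of_forall A hN, one_mul, cls_singleton] at this
    exact hO g (by simp) this
  by_cases m2 : O.card = 2
  · obtain ⟨g, h, rfl⟩ := Multiset.card_eq_two.1 m2
    obtain ⟨X, R, rfl, hX⟩ := Multiset.exists_add_card_eq (S := N) (n := 2 * K) (by omega)
    simp only [Multiset.card_add] at hn
    obtain ⟨Z, hZ, hZ0, hZ1⟩ := exists_null_of_cls_eq_one (A := A) (V := R)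
      (cls_eq_one_of_forall A fun g hg => hN g (by simp [hg])) (by omega)
    have hT := gain_insert_one (A := A) (g := g) (hO g (by simp)) (X := X)
      fun x hx => ⟨h1 x (by simp [hx]), hN x (by simp [hx])⟩
    refine AffineData.IsMinimalProductOne.false_of_gain hS ?_ hZ0 hZ1
      (hT.of_le (by omega : q - 1 ≤ X.card))
    calc Z + g ::ₘ X ≤ R + g ::ₘ X := by gcongr
      _ ≤ h ::ₘ (R + g ::ₘ X) := Multiset.le_cons_self _ _
      _ = X + R + {g, h} := by
        simp only [Multiset.insert_eq_cons, ← Multiset.singleton_add]; abel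
  obtain ⟨a, b, O', rfl, hab⟩ := exists_pair_mul_ne_one
    ((Fact.out : r.Prime).odd_of_ne_two (by omega)) A.pow_eq_one hO (by omega)
  obtain ⟨X, R, rfl, hX⟩ := Multiset.exists_add_card_eq (S := N) (n := K) ht
  simp only [Multiset.card_add, Multiset.card_pair] at hn
  obtain ⟨Z, hZ, hZ0, hZ1⟩ := exists_null A (R := R + O') (by
    rw [Multiset.card_add]; omega)
  have hT := gain_insert_two (A := A) (hO a (by simp)) (hO b (by simp)) hab (X := X)
    fun x hx => ⟨h1 x (by simp [hx]), hN x (by simp [hx])⟩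
  refine AffineData.IsMinimalProductOne.false_of_gain hS ?_ hZ0 hZ1
    (hT.of_le (by omega : q - 1 ≤ 2 * X.card))
  calc Z + ({a, b} + X) ≤ R + O' + ({a, b} + X) := by gcongr
    _ = _ := by abel

theorem gain_bichromatic_pairs (hr3 : 3 ≤ r) (hrq : r < q) (L : List (G × G))
    (hL : ∀ x ∈ L, x.1 ≠ 1 ∧ x.2 ≠ 1 ∧ A.col x.1 ≠ A.col x.2) {E : Multiset G}
    (hE : ∀ g ∈ E, g ≠ 1) (hc : E.card = L.length) :
    A.Gain ((L.map fun x => ({x.1, x.2} : Multiset G)).sum + E) (2 * L.length) := by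
  induction L generalizing E with
  | nil => exact gain_zero _
  | cons x L ih =>
    obtain ⟨e, he⟩ := Multiset.card_pos_iff_exists_mem.1 (by rw [hc]; simp : 0 < E.card)
    obtain ⟨E', rfl⟩ := Multiset.exists_cons_of_mem he
    have h1 := ih (fun y hy => hL y (List.mem_cons_of_mem _ hy)) (E := E')
      (fun g hg => hE g (by simp [hg])) (by simpa using hc)
    obtain ⟨hx1, hx2, hx⟩ := hL x (by simp)
    have h2 := (gain_of_bichromatic hr3 hrq hx1 hx2 (hE e (by simp)) hx).add h1
    convert h2 using 1
    · rw [List.map_cons, List.sum_cons]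
      simp only [← Multiset.singleton_add]
      abel
    · rw [List.length_cons]; ring

theorem card_le_of_col {f : ZMod q} {P H : Multiset G} (hS : IsMinimalProductOne (P + H))
    (hP : ∀ g ∈ P, A.col g = some f) : (P + H).card ≤ (H.card + 1) * r := by
  classical
  have : NeZero r := ⟨(Fact.out : r.Prime).ne_zero⟩
  obtain ⟨l, hlS, hl⟩ := hS.2.1
  rw [← hlS] at hS ⊢
  obtain ⟨F, hF, hp⟩ := exists_card_le_of_prefix (A := A) f l
  have hFH : F.card ≤ H.card + 1 := by
    refine hF.trans (Nat.succ_le_succ ?_)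
    have h1 : ((l.filter (A.col · ≠ some f) : List G) : Multiset G) =
        (P + H).filter (A.col · ≠ some f) := by rw [← hlS, Multiset.filter_coe]
    have h2 := congrArg Multiset.card h1
    rw [Multiset.coe_card, Multiset.filter_add, Multiset.filter_eq_nil.2 fun g hg => by
      simp [hP g hg], zero_add] at h2
    rw [h2]
    exact Multiset.card_le_card (Multiset.filter_le _ _)
  have hcard := Finset.card_le_card_of_injOn (s := Finset.range l.length)
    (t := F ×ˢ (Finset.univ : Finset (rootsOfUnity r (ZMod q))))
    (fun i => (A.τ (l.take i).prod + A.χ (l.take i).prod * f,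
      (⟨A.χ (l.take i).prod, by rw [mem_rootsOfUnity]; exact A.pow_eq_one _⟩ :
        rootsOfUnity r (ZMod q)))) ?_ ?_
  · rw [Finset.card_range, Finset.card_product, Finset.card_univ, Fintype.card_eq_nat_card]
      at hcard
    exact hcard.trans (Nat.mul_le_mul hFH (card_rootsOfUnity (ZMod q) r))
  · intro i _
    simp only [Finset.coe_product, Finset.coe_univ, Set.mem_prod, Set.mem_univ, and_true]
    exact hp _ (List.take_prefix _ _)
  · intro i hi j hj hij
    simp only [Prod.mk.injEq, Subtype.mk.injEq] at hij
    obtain ⟨h1, h2⟩ := hij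
    rw [h2] at h1
    have he := A.ext_of_eq h2 (add_right_cancel h1)
    simp only [Finset.coe_range, Set.mem_Iio] at hi hj
    rcases lt_trichotomy i j with hlt | rfl | hlt
    · exact absurd he (hS.take_prod_ne hl hlt hj)
    · rfl
    · exact absurd he.symm (hS.take_prod_ne hl hlt hi)

end AffineData

namespace AffineData

variable {G : Type*} [Group G] {q r : ℕ} [Fact q.Prime] {A : AffineData G q r} [Fact r.Prime]

theorem false_of_large_color_many (hr3 : 3 ≤ r) {K : ℕ} (hq : q = 2 * K + 1) (hrK : r ≤ K)
    {f : ZMod q} {P H : Multiset G} (hS : IsMinimalProductOne (P + H))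
    (h1 : ∀ g ∈ P + H, g ≠ 1) (hP : ∀ g ∈ P, A.col g = some f) (hH : ∀ g ∈ H, A.col g ≠ some f)
    (hn : 2 * q + 1 ≤ P.card + H.card) (hr : r ≤ P.card) (hK : K ≤ H.card)
    (hmax : ∀ c, (H.filter (A.col · = c)).card ≤ P.card ∨
      (H.filter (A.col · = c)).card ≤ K) : False := by
  classical
  obtain ⟨Q, P', rfl, hQ⟩ := Multiset.exists_add_card_eq hr
  obtain ⟨Z, hZ, hZ0, hZ1⟩ := exists_null_of_col (A := A) (S := Q)
    (fun g hg => hP g (by simp [hg])) hQ.ge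
  obtain ⟨Q', rfl⟩ := Multiset.le_iff_exists_add.1 hZ
  set U := Q' + P' + H with hU
  simp only [Multiset.card_add] at hn hQ hmax
  have hcU : U.card = Q'.card + P'.card + H.card := by simp [hU]
  have hcount : ∀ c, K + (U.map A.col).count c ≤ (U.map A.col).card := by
    intro c
    rw [Multiset.card_map, hcU, Multiset.count_map, hU, Multiset.filter_add, Multiset.card_add]
    by_cases hc : c = some f
    · subst hc
      have h2 : H.filter (fun g => some f = A.col g) = 0 :=
        Multiset.filter_eq_nil.2 fun g hg h => hH g hg h.symm
      have h3 := Multiset.card_le_card (Multiset.filter_le (fun g => some f = A.col g) (Q' + P'))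
      rw [h2, Multiset.card_zero]
      rw [Multiset.card_add] at h3
      omega
    · have h2 : (Q' + P').filter (fun g => c = A.col g) = 0 := by
        refine Multiset.filter_eq_nil.2 fun g hg h => hc (h.trans (hP g ?_))
        rw [Multiset.mem_add] at hg ⊢
        rcases hg with hg | hg <;> simp [hg]
      have h3 := Multiset.card_le_card (Multiset.filter_le (fun g => c = A.col g) H)
      have h4 := hmax c
      have h5 : (H.filter (fun g => c = A.col g)).card = (H.filter (A.col · = c)).card := by
        simp only [eq_comm]
      rw [h2, Multiset.card_zero]
      omega
  obtain ⟨L, hL, hne, hle⟩ := exists_bichromatic_pairs K (U.map A.col) hcount (by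
    rw [Multiset.card_map]; omega)
  obtain ⟨L', rfl, hle'⟩ := exists_lift_pairs A.col L U hle
  rw [List.length_map] at hL
  obtain ⟨R, hR⟩ := Multiset.le_iff_exists_add.1 hle'
  have hcardT : (L'.map fun x => ({x.1, x.2} : Multiset G)).sum.card = 2 * K := by
    rw [← hL]
    clear * -
    induction L' with
    | nil => simp
    | cons x L ih =>
      rw [List.map_cons, List.sum_cons, Multiset.card_add, ih, Multiset.card_pair,
        List.length_cons]
      ring
  have hcR := congrArg Multiset.card hR
  rw [hcU, Multiset.card_add, hcardT] at hcR
  obtain ⟨E, hE, hEc⟩ := exists_le_card_eq (S := R) (n := K) (by omega)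
  have hU1 : ∀ g ∈ U, g ≠ 1 := fun g hg => h1 g (by
    rw [hU] at hg
    simp only [Multiset.mem_add] at hg ⊢
    tauto)
  have hUm : ∀ x ∈ L', ∀ g ∈ ({x.1, x.2} : Multiset G), g ∈ U := fun x hx g hg =>
    Multiset.mem_of_le hle' (Multiset.mem_of_le
      (List.single_le_sum (by simp) _ (List.mem_map_of_mem (f := fun x : G × G =>
        ({x.1, x.2} : Multiset G)) hx)) hg)
  have hg := gain_bichromatic_pairs (A := A) hr3 (by omega) L' (fun x hx =>
    ⟨hU1 _ (hUm x hx _ (by simp)), hU1 _ (hUm x hx _ (by simp)), hne _ (List.mem_map_of_mem hx)⟩)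
    (E := E) (fun g hg => hU1 g (hR ▸ Multiset.mem_add.2 (Or.inr (Multiset.mem_of_le hE hg))))
    (by rw [hEc, hL])
  refine AffineData.IsMinimalProductOne.false_of_gain hS ?_ hZ0 hZ1
    (hg.of_le (by omega : q - 1 ≤ 2 * L'.length))
  calc Z + ((L'.map fun x => ({x.1, x.2} : Multiset G)).sum + E)
      ≤ Z + ((L'.map fun x => ({x.1, x.2} : Multiset G)).sum + R) := by gcongr
    _ = Z + (Q' + P' + H) := by rw [← hR]
    _ = _ := by abel

theorem false_of_large_color_few {K : ℕ} (hq : q = 2 * K + 1) (hrK : r ≤ K)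
    {f : ZMod q} {P H : Multiset G} (hS : IsMinimalProductOne (P + H))
    (h1 : ∀ g ∈ P + H, g ≠ 1) (hP : ∀ g ∈ P, A.col g = some f) (hH : ∀ g ∈ H, A.col g ≠ some f)
    (hn : 2 * q + 1 ≤ P.card + H.card) (hK : H.card < K) : False := by
  by_cases hj : q - 1 ≤ H.card * (r - 1)
  · obtain ⟨Q, P', rfl, hQ⟩ := Multiset.exists_add_card_eq (S := P) (n := q - 1) (by omega)
    rw [Multiset.card_add] at hn
    obtain ⟨Z, hZ, hZ0, hZ1⟩ := exists_null_of_col (A := A) (S := P') (r := r)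
      (fun g hg => hP g (by simp [hg])) (by omega)
    have hg := gain_colors (A := A) (P := some f) (H := H) (S := Q)
      (fun g hg => ⟨h1 g (by simp [hg]), hH g hg⟩)
      (fun g hg => ⟨h1 g (by simp [hg]), hP g (by simp [hg])⟩)
    refine AffineData.IsMinimalProductOne.false_of_gain hS ?_ hZ0 hZ1 (hg.of_le ?_)
    · calc Z + (H + Q) ≤ P' + (H + Q) := by gcongr
        _ = _ := by abel
    · rw [hQ]; exact le_min le_rfl hj
  · have h2 := card_le_of_col (A := A) hS hP
    rw [Multiset.card_add] at h2
    obtain ⟨s, hs⟩ : ∃ s, r = s + 1 := ⟨r - 1, by have := (Fact.out : r.Prime).pos; omega⟩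
    have h3 : r - 1 = s := by omega
    rw [h3] at hj
    have h4 : (H.card + 1) * r = H.card * s + H.card + r := by
      conv_lhs => rw [hs]
      conv_rhs => rw [hs]
      ring
    omega

theorem false_of_large_color (hr3 : 3 ≤ r) {K : ℕ} (hq : q = 2 * K + 1) (hrK : r ≤ K)
    {S : Multiset G} (hS : IsMinimalProductOne S) (h1 : ∀ g ∈ S, g ≠ 1) (hn : 2 * q + 1 ≤ S.card)
    (ht : (S.filter (A.χ · = 1)).card ≤ K)
    (hf : ∃ f, r ≤ (S.filter (A.col · = some f)).card) : False := by
  classical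
  obtain ⟨f₀, hf₀⟩ := hf
  obtain ⟨f, -, hmax⟩ := Finset.univ.exists_max_image
    (fun f : ZMod q => (S.filter (A.col · = some f)).card) ⟨f₀, Finset.mem_univ _⟩
  have hr : r ≤ (S.filter (A.col · = some f)).card := hf₀.trans (hmax f₀ (Finset.mem_univ _))
  have hsplit := Multiset.filter_add_not (fun g => A.col g = some f) S
  have hle : ∀ c, ((S.filter fun g => ¬ A.col g = some f).filter (A.col · = c)).card ≤
      (S.filter (A.col · = c)).card := fun c =>
    Multiset.card_le_card (Multiset.filter_le_filter _ (Multiset.filter_le _ _))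
  have hmax' : ∀ c, ((S.filter fun g => ¬ A.col g = some f).filter (A.col · = c)).card ≤
      (S.filter (A.col · = some f)).card ∨
      ((S.filter fun g => ¬ A.col g = some f).filter (A.col · = c)).card ≤ K := by
    intro c
    cases c with
    | none =>
      refine Or.inr ((hle none).trans ?_)
      simpa only [col_eq_none] using ht
    | some f' => exact Or.inl ((hle _).trans (hmax f' (Finset.mem_univ _)))
  have hcard := congrArg Multiset.card hsplit
  rw [Multiset.card_add] at hcard
  by_cases hK : K ≤ (S.filter fun g => ¬ A.col g = some f).card
  · exact false_of_large_color_many hr3 hq hrK (P := S.filter fun g => A.col g = some f)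
      (H := S.filter fun g => ¬ A.col g = some f) (hsplit.symm ▸ hS) (hsplit.symm ▸ h1)
      (fun g hg => (Multiset.mem_filter.1 hg).2) (fun g hg => (Multiset.mem_filter.1 hg).2)
      (by omega) hr hK hmax'
  · exact false_of_large_color_few hq hrK (P := S.filter fun g => A.col g = some f)
      (H := S.filter fun g => ¬ A.col g = some f) (hsplit.symm ▸ hS) (hsplit.symm ▸ h1)
      (fun g hg => (Multiset.mem_filter.1 hg).2) (fun g hg => (Multiset.mem_filter.1 hg).2)
      (by omega) (by omega)

end AffineData

namespace AffineData

variable {G : Type*} [Group G] {q r : ℕ} [Fact q.Prime] {A : AffineData G q r} [Fact r.Prime]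

theorem count_map_col_lt [DecidableEq (Option (ZMod q))] {S U : Multiset G} (hUS : U ≤ S)
    (hU : ∀ g ∈ U, A.χ g ≠ 1) (hf : ∀ f, (S.filter (A.col · = some f)).card < r)
    (c : Option (ZMod q)) : (U.map A.col).count c + 1 ≤ r := by
  cases c with
  | none =>
    rw [Multiset.count_eq_zero.2]
    · exact (Fact.out : r.Prime).one_lt.le
    · intro h
      obtain ⟨g, hg, h⟩ := Multiset.mem_map.1 h
      exact hU g hg (col_eq_none.1 h)
  | some f =>
    rw [Multiset.count_map]
    refine (Nat.succ_le_succ (Multiset.card_le_card (Multiset.filter_le_filter _ hUS))).trans ?_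
    have := hf f
    simp only [eq_comm (a := some f)]
    omega

theorem false_of_null_of_remainder {κ : ℕ} (hκ : 1 ≤ κ) (hr3 : 3 ≤ r) (hq : q = 2 * κ * r + 1)
    {S Z U : Multiset G} (hS : IsMinimalProductOne S)
    (hf : ∀ f, (S.filter (A.col · = some f)).card < r) (hle : Z + U ≤ S) (hZ0 : Z ≠ 0)
    (hZ : IsProductOne Z) (hU : ∀ g ∈ U, A.χ g ≠ 1) (hcard : q + 1 ≤ U.card) : False := by
  classical
  refine AffineData.IsMinimalProductOne.false_of_gain hS hle hZ0 hZ
    (gain_of_count_col_le hκ hr3 hq hU hcard (count_map_col_lt ?_ hU hf))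
  exact (Multiset.le_add_left U Z).trans hle

theorem false_of_large_class {κ : ℕ} (hκ : 1 ≤ κ) (hr3 : 3 ≤ r) (hq : q = 2 * κ * r + 1)
    {N O : Multiset G} (hS : IsMinimalProductOne (N + O)) (hO : ∀ g ∈ O, A.χ g ≠ 1)
    (hf : ∀ f, ((N + O).filter (A.col · = some f)).card < r)
    (hm : q + r + 1 ≤ O.card) {e : (ZMod q)ˣ} (her : e ^ r = 1)
    (he : q + r ≤ (O.filter (A.χ · = e)).card + 1) : False := by
  classical
  obtain ⟨Z, hZ, hZc, hZ1⟩ := exists_null_of_χ_eq (A := A) her (Y := O.filter (A.χ · = e))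
    (fun g hg => (Multiset.mem_filter.1 hg).2) (fun x => by
      by_cases hx : x ∈ O
      · have h1 := count_map_col_lt (Multiset.le_add_left O N) hO hf (A.col x)
        have h2 : O.count x ≤ (O.map A.col).count (A.col x) := by
          rw [Multiset.count_map, ← Multiset.card_replicate (O.count x) x,
            ← Multiset.filter_eq]
          exact Multiset.card_le_card (Multiset.monotone_filter_right _ fun y h => h ▸ rfl)
        have h3 := Multiset.count_le_of_le x (Multiset.filter_le (A.χ · = e) O)
        omega
      · rw [Multiset.count_eq_zero.2 fun h => hx (Multiset.mem_filter.1 h).1]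
        exact Nat.zero_le _) he
  obtain ⟨U, rfl⟩ := Multiset.le_iff_exists_add.1 (hZ.trans (Multiset.filter_le _ _))
  have hr := (Fact.out : r.Prime).pos
  refine false_of_null_of_remainder (A := A) hκ hr3 hq hS hf (Multiset.le_add_left _ N)
    (Multiset.card_pos.1 (by omega)) hZ1 (fun g hg => hO g (by simp [hg])) ?_
  rw [Multiset.card_add] at hm
  omega

theorem false_of_translations_of_class {κ : ℕ} (hr3 : 3 ≤ r) (hq : q = 2 * κ * r + 1)
    (hκr : 3 * κ + 2 * r ≤ 2 * κ * r + 3)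
    {N O : Multiset G} (hS : IsMinimalProductOne (N + O)) (hN : ∀ g ∈ N, g ≠ 1 ∧ A.χ g = 1)
    (hn : 2 * q + 1 ≤ N.card + O.card) (ht : 3 * κ ≤ N.card) {e : (ZMod q)ˣ} (he : e ≠ 1)
    (her : e ^ r = 1) (hc : r ≤ (O.filter (A.χ · = e)).card + 1) : False := by
  classical
  obtain ⟨Y, hY, hYc⟩ := exists_le_card_eq (S := O.filter (A.χ · = e)) (n := r - 1) (by omega)
  obtain ⟨O', rfl⟩ := Multiset.le_iff_exists_add.1 (hY.trans (Multiset.filter_le _ _))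
  obtain ⟨X, N', rfl, hX⟩ := Multiset.exists_add_card_eq ht
  obtain ⟨l, hl⟩ : ∃ l : List G, (l : Multiset G) = Y := Quot.exists_rep Y
  subst hl
  have hYm : ∀ g ∈ l, A.χ g = e := fun g hg => (Multiset.mem_filter.1 (Multiset.mem_of_le hY hg)).2
  have hlen : l.length + 1 = r := by
    have : l.length = r - 1 := hYc
    omega
  have hg := gain_insert_replicate (A := A) he her hYm hlen (X := X)
    fun x hx => hN x (by simp [hx])
  simp only [Multiset.card_add, hYc] at hn
  obtain ⟨Z, hZ, hZ0, hZ1⟩ := exists_null A (R := N' + O') (by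
    rw [Multiset.card_add]; omega)
  refine AffineData.IsMinimalProductOne.false_of_gain hS ?_ hZ0 hZ1 (hg.of_le ?_)
  · calc Z + ((l : Multiset G) + X) ≤ N' + O' + ((l : Multiset G) + X) := by gcongr
      _ = X + N' + ((l : Multiset G) + O') := by abel
  · obtain ⟨s, rfl⟩ := Nat.exists_eq_add_of_le hr3
    rw [hX, hq, show 3 + s - 1 = 2 + s by omega]
    have h1 : 2 * κ * (3 + s) = 6 * κ + 2 * (κ * s) := by ring
    have h2 : (2 + s) * (3 * κ) = 6 * κ + 3 * (κ * s) := by ring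
    omega

theorem mem_of_le_card {D : Finset (ZMod q)ˣ} (hD : ∀ u ∈ D, u ^ r = 1) (hr : r ≤ D.card)
    {u : (ZMod q)ˣ} (hu : u ^ r = 1) : u ∈ D := by
  classical
  have : NeZero r := ⟨(Fact.out : r.Prime).ne_zero⟩
  by_contra h
  have h1 := Finset.card_le_card_of_injOn (s := insert u D)
    (t := (Finset.univ : Finset (rootsOfUnity r (ZMod q))).map (Function.Embedding.subtype _))
    id (fun x hx => by
      have hx' : x ^ r = 1 := by
        rcases Finset.mem_insert.1 hx with rfl | hx
        exacts [hu, hD x hx]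
      simpa [mem_rootsOfUnity] using hx') (Set.injOn_id _)
  rw [Finset.card_insert_of_notMem h, Finset.card_map, Finset.card_univ,
    Fintype.card_eq_nat_card] at h1
  have := card_rootsOfUnity (ZMod q) r
  omega

theorem false_of_spread_classes {κ : ℕ} (hκ : 1 ≤ κ) (hr3 : 3 ≤ r) (hq : q = 2 * κ * r + 1)
    {N O : Multiset G} (hS : IsMinimalProductOne (N + O)) (hN : ∀ g ∈ N, A.χ g = 1)
    (hO : ∀ g ∈ O, A.χ g ≠ 1) (hf : ∀ f, ((N + O).filter (A.col · = some f)).card < r)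
    (hn : 2 * q + 1 ≤ N.card + O.card) (ht : N.card + r ≤ q)
    (hc : ∀ e, (O.filter (A.χ · = e)).card + r ≤ O.card + 1) : False := by
  classical
  have hκr : r ≤ κ * r := Nat.le_mul_of_pos_left _ hκ
  have hq' : q = 2 * (κ * r) + 1 := by rw [hq]; ring
  obtain ⟨L, hL, hne, hle⟩ := exists_bichromatic_pairs (r - 1) (O.map A.χ)
    (fun e => by
      rw [Multiset.card_map, Multiset.count_map]
      have := hc e
      simp only [eq_comm (a := e)]
      omega) (by rw [Multiset.card_map]; omega)
  obtain ⟨L', rfl, hle'⟩ := exists_lift_pairs A.χ L O hle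
  rw [List.length_map] at hL
  obtain ⟨R, hR⟩ := Multiset.le_iff_exists_add.1 hle'
  obtain ⟨D, hD, hDc⟩ := exists_choices (A := A)
    (L'.map fun x => (({x.1} : Multiset G), ({x.2} : Multiset G))) (by
      intro y hy
      obtain ⟨x, hx, rfl⟩ := List.mem_map.1 hy
      simpa using hne _ (List.mem_map_of_mem hx))
  rw [List.length_map, hL] at hD
  have hcardT : (L'.map fun x => ({x.1, x.2} : Multiset G)).sum.card = 2 * (r - 1) := by
    rw [← hL]
    clear * -
    induction L' with
    | nil => simp
    | cons x L ih =>
      rw [List.map_cons, List.sum_cons, Multiset.card_add, ih, Multiset.card_pair,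
        List.length_cons]
      ring
  have hcR := congrArg Multiset.card hR
  rw [Multiset.card_add, hcardT] at hcR
  obtain ⟨W, R', rfl, hW⟩ := Multiset.exists_add_card_eq (S := R) (n := q + 1 - r - N.card)
    (by omega)
  obtain ⟨a, b, hab, ha, hcard⟩ := hDc (A.cls W)⁻¹ (mem_of_le_card (fun u hu => by
    obtain ⟨a, -, -, rfl, -⟩ := hDc u hu
    exact A.cls_pow a) (by omega) (by rw [inv_pow, A.cls_pow, inv_one]))
  have hab' : a + b = (L'.map fun x => ({x.1, x.2} : Multiset G)).sum := by
    rw [hab, List.map_map]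
    rfl
  have hcab : a.card = b.card := hcard (by
    intro y hy
    obtain ⟨x, -, rfl⟩ := List.mem_map.1 hy
    rfl)
  have hcab' := congrArg Multiset.card hab'
  rw [hcardT, Multiset.card_add] at hcab'
  rw [← hab'] at hR
  subst hR
  obtain ⟨Z, hZ, hZ0, hZ1⟩ := exists_null_of_cls_eq_one (A := A) (V := N + W + a)
    (by rw [cls_add, cls_add, cls_eq_one_of_forall A hN, ha, one_mul, mul_inv_cancel])
    (by simp only [Multiset.card_add]; omega)
  simp only [Multiset.card_add] at hn hcR
  refine false_of_null_of_remainder (A := A) hκ hr3 hq hS hf (U := b + R') ?_ hZ0 hZ1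
    (fun g hg => hO g ?_) ?_
  · calc Z + (b + R') ≤ N + W + a + (b + R') := by gcongr
      _ = _ := by abel
  · simp only [Multiset.mem_add] at hg ⊢
    tauto
  · rw [Multiset.card_add]; omega

/-- Minimal product-one sequences over a group with a faithful affine action on `ZMod q`
whose multipliers have odd prime order have at most `2 * q` terms. -/
theorem atomBound (A : AffineData G q r) {κ : ℕ} (hκ : 1 ≤ κ) (hr3 : 3 ≤ r)
    (hq : q = 2 * κ * r + 1) : AtomBound G (2 * q) := by
  classical
  intro S hS
  by_contra! hn
  have hκr : r ≤ κ * r := Nat.le_mul_of_pos_left _ hκ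
  have hq' : q = 2 * (κ * r) + 1 := by rw [hq]; ring
  have harith : 3 * κ + 2 * r ≤ 2 * κ * r + 3 := by
    obtain ⟨s, hs⟩ := Nat.exists_eq_add_of_le hr3
    obtain ⟨k, hk⟩ := Nat.exists_eq_add_of_le hκ
    have : 2 * κ * r = 2 * (k * s) + 6 * k + 2 * s + 6 := by rw [hs, hk]; ring
    omega
  have h3 : 2 * κ * r = 2 * (κ * r) := by ring
  have h1 : ∀ g ∈ S, g ≠ 1 := fun g hg h => hS.one_notMem (by omega) (h ▸ hg)
  set N := S.filter (A.χ · = 1) with hNdef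
  set O := S.filter (fun g => ¬ A.χ g = 1) with hOdef
  have hNO : N + O = S := Multiset.filter_add_not _ S
  have hN : ∀ g ∈ N, A.χ g = 1 := fun g hg => (Multiset.mem_filter.1 hg).2
  have hO : ∀ g ∈ O, A.χ g ≠ 1 := fun g hg => (Multiset.mem_filter.1 hg).2
  have hN1 : ∀ g ∈ N, g ≠ 1 := fun g hg => h1 g (Multiset.mem_filter.1 hg).1
  have hcard := congrArg Multiset.card hNO
  rw [Multiset.card_add] at hcard
  by_cases ht : κ * r ≤ N.card
  · exact false_of_many_translations (A := A) hr3 hq' hκr (hNO ▸ hS) hN1 hN hO (by omega) ht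
  by_cases hf : ∃ f, r ≤ (S.filter (A.col · = some f)).card
  · exact false_of_large_color (A := A) hr3 hq' hκr hS h1 (by omega)
      (show N.card ≤ _ by omega) hf
  push Not at hf
  rw [← hNO] at hf hS
  have hroot : ∀ e, O.filter (A.χ · = e) ≠ 0 → e ≠ 1 ∧ e ^ r = 1 := by
    intro e he
    obtain ⟨g, hg⟩ := Multiset.exists_mem_of_ne_zero he
    obtain ⟨hgO, rfl⟩ := Multiset.mem_filter.1 hg
    exact ⟨hO g hgO, A.pow_eq_one g⟩
  refine false_of_spread_classes (A := A) hκ hr3 hq hS hN hO hf (by omega) (by omega) fun e => ?_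
  by_cases h0 : O.filter (A.χ · = e) = 0
  · rw [h0, Multiset.card_zero]; omega
  obtain ⟨he, her⟩ := hroot e h0
  by_contra! hlt
  by_cases hbig : q + r ≤ (O.filter (A.χ · = e)).card + 1
  · exact false_of_large_class (A := A) hκ hr3 hq hS hO hf (by omega) her hbig
  · exact false_of_translations_of_class (A := A) hr3 hq harith hS
      (fun g hg => ⟨hN1 g hg, hN g hg⟩) (by omega) (by omega) he her (by omega)

end AffineData

section ElementaryAbelian

variable {p : ℕ} [Fact p.Prime]

open MvPolynomial in
theorem exists_nonempty_sum_eq_zero {ι : Type*} [Fintype ι] (a b : ι → ZMod p)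
    (h : 2 * (p - 1) < Fintype.card ι) :
    ∃ t : Finset ι, t.Nonempty ∧ ∑ i ∈ t, a i = 0 ∧ ∑ i ∈ t, b i = 0 := by
  classical
  have hp := (Fact.out : p.Prime)
  let F : (ι → ZMod p) → MvPolynomial ι (ZMod p) := fun c => ∑ i, c i • X i ^ (p - 1)
  have hF : ∀ c, (F c).totalDegree ≤ p - 1 := fun c => totalDegree_finsetSum_le fun i _ =>
    (totalDegree_smul_le ..).trans (totalDegree_X_pow ..).le
  have hev : ∀ c x, eval x (F c) = ∑ i ∈ Finset.univ.filter (x · ≠ 0), c i := by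
    intro c x
    simp [F, ZMod.pow_card_sub_one, Finset.sum_filter]
  have hdvd := char_dvd_card_solutions_of_add_lt p (f₁ := F a) (f₂ := F b)
    (by have := hF a; have := hF b; omega)
  let z : {x : ι → ZMod p // eval x (F a) = 0 ∧ eval x (F b) = 0} := ⟨0, by rw [hev]; simp, by rw [hev]; simp⟩
  obtain ⟨x, hx⟩ := Fintype.exists_ne_of_one_lt_card (hp.one_lt.trans_le
    (Nat.le_of_dvd (Fintype.card_pos_iff.2 ⟨z⟩) hdvd)) z
  refine ⟨Finset.univ.filter (x.1 · ≠ 0), ?_, by rw [← hev]; exact x.2.1,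
    by rw [← hev]; exact x.2.2⟩
  rw [← Subtype.coe_ne_coe, Function.ne_iff] at hx
  exact hx.imp fun i hi => Finset.mem_filter.2 ⟨Finset.mem_univ _, hi⟩

theorem isProductOne_of_prod_eq_one {G : Type*} [CommGroup G] {S : Multiset G}
    (h : S.prod = 1) : IsProductOne S := by
  obtain ⟨l, rfl⟩ : ∃ l : List G, (l : Multiset G) = S := Quot.exists_rep S
  exact isProductOne_coe (by simpa using h)

theorem IsProductOne.prod_eq_one {G : Type*} [CommGroup G] {S : Multiset G}
    (h : IsProductOne S) : S.prod = 1 := by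
  obtain ⟨l, rfl, hl⟩ := h
  simpa using hl

theorem atomBound_zmod_prod :
    AtomBound (Multiplicative (ZMod p) × Multiplicative (ZMod p)) (2 * p) := by
  classical
  intro S hS
  by_contra! hn
  obtain ⟨U, V, rfl, hU⟩ := Multiset.exists_add_card_eq (S := S) (n := 2 * p - 1) (by omega)
  have hp := (Fact.out : p.Prime).pos
  obtain ⟨t, ht, ha, hb⟩ := exists_nonempty_sum_eq_zero (ι := U)
    (fun i => i.1.1.toAdd) (fun i => i.1.2.toAdd) (by rw [Multiset.card_coe]; omega)
  set T : Multiset (Multiplicative (ZMod p) × Multiplicative (ZMod p)) :=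
    t.val.map fun i => i.1 with hT
  have hTU : T ≤ U := by
    conv_rhs => rw [← Multiset.map_univ_coe U]
    exact Multiset.map_le_map (Finset.val_le_iff.2 (Finset.subset_univ t))
  have hT1 : T.prod = 1 := by
    change ∏ i ∈ t, i.1 = 1
    refine Prod.ext ?_ ?_
    · rw [Prod.fst_prod]
      exact Multiplicative.toAdd.injective (by rw [toAdd_prod, ha]; rfl)
    · rw [Prod.snd_prod]
      exact Multiplicative.toAdd.injective (by rw [toAdd_prod, hb]; rfl)
  obtain ⟨W, hW⟩ := Multiset.le_iff_exists_add.1 hTU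
  have hSp := hS.2.1.prod_eq_one
  rw [hW, add_assoc, Multiset.prod_add, hT1, one_mul] at hSp
  have hTc : T.card = t.card := Multiset.card_map _ _
  have ht0 := Finset.card_pos.2 ht
  have hTU' := Multiset.card_le_card hTU
  rw [Multiset.card_add] at hn
  rcases hS.eq_zero_or_eq_zero (by rw [hW, add_assoc]) (isProductOne_of_prod_eq_one hT1)
    (isProductOne_of_prod_eq_one hSp) with h | h
  · rw [h, Multiset.card_zero] at hTc
    omega
  · have h' := congrArg Multiset.card h
    rw [Multiset.card_add, Multiset.card_zero] at h'
    omega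

variable {G : Type*} [Group G]

theorem exists_injective_prod_of_commute {x y : G} (hx : orderOf x = p) (hy : orderOf y = p)
    (hxy : Commute x y) (h : y ∉ Subgroup.zpowers x) :
    ∃ f : Multiplicative (ZMod p) × Multiplicative (ZMod p) →* G, Function.Injective f := by
  have hp := (Fact.out : p.Prime)
  let e : ∀ z : G, orderOf z = p → (Multiplicative (ZMod p) ≃* Subgroup.zpowers z) :=
    fun z hz => mulEquivOfPrimeCardEq (p := p) (by simp) (by rw [Nat.card_zpowers, hz])
  refine ⟨MonoidHom.noncommCoprod ((Subgroup.subtype _).comp (e x hx).toMonoidHom)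
    ((Subgroup.subtype _).comp (e y hy).toMonoidHom) ?_, ?_⟩
  · intro a b
    obtain ⟨i, hi⟩ := (e x hx a).2
    obtain ⟨j, hj⟩ := (e y hy b).2
    change Commute ((e x hx a : Subgroup.zpowers x) : G) (e y hy b : Subgroup.zpowers y)
    rw [← hi, ← hj]
    exact hxy.zpow_zpow i j
  · rw [MonoidHom.noncommCoprod_injective]
    refine ⟨Subtype.val_injective.comp (e x hx).injective,
      Subtype.val_injective.comp (e y hy).injective, ?_⟩
    rw [Subgroup.disjoint_def]
    rintro g ⟨a, rfl⟩ ⟨b, hb⟩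
    by_contra hne
    refine h ?_
    change ((e y hy b : Subgroup.zpowers y) : G) = (e x hx a : Subgroup.zpowers x) at hb
    change ((e x hx a : Subgroup.zpowers x) : G) ≠ 1 at hne
    have hb1 : e y hy b ≠ 1 := fun h1 => hne (by rw [← hb, h1]; rfl)
    have htop := zpowers_eq_top_of_prime_card (p := p)
      (by rw [Nat.card_zpowers, hy]) hb1
    have hmem : (⟨y, Subgroup.mem_zpowers y⟩ : Subgroup.zpowers y) ∈
        Subgroup.zpowers (e y hy b) := htop ▸ Subgroup.mem_top _
    obtain ⟨k, hk⟩ := hmem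
    have hk' := congrArg Subtype.val hk
    change ((e y hy b : Subgroup.zpowers y) : G) ^ k = y at hk'
    rw [← hk', hb]
    exact Subgroup.zpow_mem _ (e x hx a).2 k

theorem atomBound_of_commute [Finite G] {x y : G} (hx : orderOf x = p) (hy : orderOf y = p)
    (hxy : Commute x y) (h : y ∉ Subgroup.zpowers x) :
    ∃ B, AtomBound G B ∧ p * B ≤ 2 * Nat.card G := by
  obtain ⟨f, hf⟩ := exists_injective_prod_of_commute hx hy hxy h
  refine ⟨_, AtomBound.of_injective hf atomBound_zmod_prod, ?_⟩
  have hc : Nat.card f.range = p * p := by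
    rw [← Nat.card_congr (MonoidHom.ofInjective hf).toEquiv, Nat.card_prod]
    simp
  rw [← f.range.card_mul_index, hc]
  exact le_of_eq (by ring)

end ElementaryAbelian

section PGroup

variable {p : ℕ} [Fact p.Prime] {G : Type*} [Group G]

theorem pow_mul_eq_of_commutator_central {x y z : G} (h : y * x = x * y * z)
    (hz : ∀ g, Commute z g) (n : ℕ) : y ^ n * x = x * y ^ n * z ^ n := by
  induction n with
  | zero => simp
  | succ n ih =>
    calc y ^ (n + 1) * x = y ^ n * x * y * z := by rw [pow_succ, mul_assoc, h]; group
      _ = x * y ^ n * (z ^ n * y) * z := by rw [ih]; group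
      _ = _ := by rw [((hz y).pow_left n).eq]; group

theorem mul_pow_of_commutator_central {x y z : G} (h : y * x = x * y * z)
    (hz : ∀ g, Commute z g) (n : ℕ) : (x * y) ^ n = x ^ n * y ^ n * z ^ n.choose 2 := by
  induction n with
  | zero => simp
  | succ n ih =>
    calc (x * y) ^ (n + 1) = x ^ n * y ^ n * (z ^ n.choose 2 * (x * y)) := by
          rw [pow_succ, ih, mul_assoc]
      _ = x ^ n * (y ^ n * x) * y * z ^ n.choose 2 := by
          rw [((hz (x * y)).pow_left _).eq]; simp only [mul_assoc]
      _ = x ^ n * (x * y ^ n) * (z ^ n * y) * z ^ n.choose 2 := by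
          rw [pow_mul_eq_of_commutator_central h hz]; simp only [mul_assoc]
      _ = _ := by
          rw [((hz y).pow_left n).eq, Nat.choose_succ_succ' n 1, Nat.choose_one_right, pow_add z,
            pow_succ x, pow_succ y]
          simp only [mul_assoc]

theorem IsPGroup.exists_le_index_eq [Finite G] (hG : IsPGroup p G) {H : Subgroup G}
    (hH : H ≠ ⊤) : ∃ M : Subgroup G, H ≤ M ∧ M.Normal ∧ M.index = p := by
  have hp := (Fact.out : p.Prime)
  obtain ⟨k, hk⟩ := IsPGroup.iff_card.1 hG
  obtain ⟨n, hn⟩ := IsPGroup.iff_card.1 (hG.to_subgroup H)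
  have hlt : Nat.card H < Nat.card G :=
    lt_of_le_of_ne (Subgroup.card_le_card_group H) fun h => hH (Subgroup.eq_top_of_card_eq H h)
  rw [hn, hk] at hlt
  have hnk := (Nat.pow_lt_pow_iff_right hp.one_lt).1 hlt
  obtain ⟨M, hM, hHM⟩ := Sylow.exists_subgroup_card_pow_prime_le p (m := k - 1)
    (hk ▸ pow_dvd_pow p (Nat.sub_le k 1)) H hn (by omega)
  have hidx : M.index = p := by
    have h := M.card_mul_index
    rw [hM, hk] at h
    refine Nat.eq_of_mul_eq_mul_left (pow_pos hp.pos (k - 1)) (h.trans ?_)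
    rw [← pow_succ]
    congr 1
    omega
  refine ⟨M, hHM, Subgroup.normal_of_index_eq_minFac_card ?_, hidx⟩
  rw [hidx, hk, hp.pow_minFac (by omega)]

/-- A noncyclic group of odd prime power order in which all proper subgroups are cyclic has a
subgroup of type `(p, p)`. -/
theorem IsPGroup.exists_commute_of_forall_isCyclic [Finite G] (hG : IsPGroup p G) (hp2 : p ≠ 2)
    (hc : ¬ IsCyclic G) (h : ∀ H : Subgroup G, H ≠ ⊤ → IsCyclic H) :
    ∃ x y : G, orderOf x = p ∧ orderOf y = p ∧ Commute x y ∧ y ∉ Subgroup.zpowers x := by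
  have hp := (Fact.out : p.Prime)
  have hzp : ∀ x : G, Subgroup.zpowers x ≠ ⊤ := fun x hx =>
    hc ⟨x, fun y => (hx ▸ Subgroup.mem_top y : y ∈ Subgroup.zpowers x)⟩
  have hcomm : ∀ M : Subgroup G, M ≠ ⊤ → ∀ a ∈ M, ∀ b ∈ M, Commute a b := by
    intro M hM a ha b hb
    have := h M hM
    exact congrArg Subtype.val (mul_comm' (⟨a, ha⟩ : M) ⟨b, hb⟩)
  have hne : ∀ M : Subgroup G, M.index = p → M ≠ ⊤ := by
    rintro M hM rfl
    rw [Subgroup.index_top] at hM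
    exact hp.ne_one hM.symm
  have hpow : ∀ M : Subgroup G, M.Normal → M.index = p → ∀ g, g ^ p ∈ M := by
    intro M hM hi g
    rw [← hi]
    exact Subgroup.pow_index_mem M g
  have hcm : ∀ M : Subgroup G, M.Normal → M.index = p → ∀ a b : G, b⁻¹ * a⁻¹ * b * a ∈ M := by
    intro M hM hi a b
    have hcyc : IsCyclic (G ⧸ M) := isCyclic_of_prime_card (p := p) hi
    rw [← QuotientGroup.eq_one_iff]
    change (b : G ⧸ M)⁻¹ * (a : G ⧸ M)⁻¹ * b * a = 1
    rw [mul_comm' (b : G ⧸ M)⁻¹ (a : G ⧸ M)⁻¹]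
    group
  -- Two noncommuting elements lie in distinct abelian maximal subgroups, which generate `G`.
  have hcen : ∀ x y : G, ¬ Commute x y → ∀ z, (∀ M : Subgroup G, M.Normal → M.index = p →
      (x ∈ M ∨ y ∈ M) → z ∈ M) → ∀ g, Commute z g := by
    intro x y hxy z hz g
    obtain ⟨M, hM, hMn, hMi⟩ := hG.exists_le_index_eq (hzp x)
    obtain ⟨N, hN, hNn, hNi⟩ := hG.exists_le_index_eq (hzp y)
    have hxM : x ∈ M := hM (Subgroup.mem_zpowers x)
    have hyN : y ∈ N := hN (Subgroup.mem_zpowers y)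
    have hzM := hz M hMn hMi (Or.inl hxM)
    have hzN := hz N hNn hNi (Or.inr hyN)
    have htop : Subgroup.centralizer {z} = ⊤ := by
      by_contra hne'
      exact hxy (hcomm _ hne' x (Subgroup.mem_centralizer_singleton_iff.2
        (hcomm M (hne M hMi) x hxM z hzM)) y (Subgroup.mem_centralizer_singleton_iff.2
        (hcomm N (hne N hNi) y hyN z hzN)))
    have := htop ▸ Subgroup.mem_top g
    exact (Subgroup.mem_centralizer_singleton_iff.1 this).symm
  have hmul : ∀ x y : G, (x * y) ^ p = x ^ p * y ^ p := by
    intro x y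
    by_cases hxy : Commute x y
    · exact hxy.mul_pow p
    have hz : ∀ g, Commute (y⁻¹ * x⁻¹ * y * x) g :=
      hcen x y hxy _ fun M hM hi _ => hcm M hM hi _ _
    have hyx : y * x = x * y * (y⁻¹ * x⁻¹ * y * x) := by group
    have hy : Commute (y ^ p) x := hcen x y hxy _ (fun M hM hi _ => hpow M hM hi y) x
    have hzp1 := pow_mul_eq_of_commutator_central hyx hz p
    rw [hy.eq, left_eq_mul] at hzp1
    obtain ⟨k, hk⟩ := hp.dvd_choose_self (k := 2) two_ne_zero
      (lt_of_le_of_ne hp.two_le hp2.symm)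
    rw [mul_pow_of_commutator_central hyx hz, hk, pow_mul, hzp1, one_pow, mul_one]
  let φ : G →* G := ⟨⟨(· ^ p), one_pow p⟩, hmul⟩
  have hφ : ∀ g, g ∈ φ.ker ↔ g ^ p = 1 := fun g => Iff.rfl
  have hone : ∀ g ∈ φ.ker, g ≠ 1 → orderOf g = p := fun g hg hg1 =>
    orderOf_eq_prime ((hφ g).1 hg) hg1
  have hker : p < Nat.card φ.ker := by
    by_contra! hle
    have hnt : Nontrivial G := by
      by_contra hnt
      rw [not_nontrivial_iff_subsingleton] at hnt
      exact hc inferInstance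
    have hrange : φ.range ≠ ⊤ := by
      obtain ⟨M, -, hMn, hMi⟩ := hG.exists_le_index_eq (bot_ne_top (α := Subgroup G))
      intro h'
      refine hne M hMi (top_le_iff.1 (h' ▸ ?_))
      rintro _ ⟨g, rfl⟩
      exact hpow M hMn hMi g
    have hmem : ∀ M : Subgroup G, M.Normal → M.index = p → M = φ.range := by
      intro M hMn hMi
      symm
      refine Subgroup.eq_of_le_of_card_ge ?_ ?_
      · rintro _ ⟨g, rfl⟩
        exact hpow M hMn hMi g
      · have h1 := M.card_mul_index
        have h2 := φ.ker.card_mul_index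
        rw [Subgroup.index_ker] at h2
        rw [hMi] at h1
        refine Nat.le_of_mul_le_mul_left ?_ hp.pos
        calc p * Nat.card M = Nat.card φ.ker * Nat.card φ.range := by rw [h2, ← h1, mul_comm]
          _ ≤ _ := Nat.mul_le_mul_right _ hle
    obtain ⟨g, hg⟩ : ∃ g, g ∉ φ.range := by
      by_contra! hall
      exact hrange (eq_top_iff.2 fun g _ => hall g)
    obtain ⟨M, hM, hMn, hMi⟩ := hG.exists_le_index_eq (hzp g)
    exact hg (hmem M hMn hMi ▸ hM (Subgroup.mem_zpowers g))
  have hnt : Nontrivial φ.ker := Finite.one_lt_card_iff_nontrivial.1 (hp.one_lt.trans hker)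
  have hcn := (hG.to_subgroup φ.ker).center_nontrivial
  obtain ⟨⟨x, hx⟩, hx1⟩ := exists_ne (1 : Subgroup.center φ.ker)
  have hxo : orderOf (x : G) = p := hone x x.2 fun h1 => hx1 (by ext; exact h1)
  obtain ⟨y, hy, hyx⟩ : ∃ y ∈ φ.ker, y ∉ Subgroup.zpowers (x : G) := by
    by_contra! hle
    have := Subgroup.card_le_of_le hle
    rw [Nat.card_zpowers, hxo] at this
    omega
  refine ⟨x, y, hxo, hone y hy fun h1 => hyx (h1 ▸ one_mem _), ?_, hyx⟩
  exact (congrArg Subtype.val (Subgroup.mem_center_iff.1 hx ⟨y, hy⟩)).symm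

/-- A noncyclic group of odd prime power order has a subgroup of type `(p, p)`. -/
theorem IsPGroup.exists_commute_of_not_isCyclic [Finite G] (hG : IsPGroup p G) (hp2 : p ≠ 2)
    (hc : ¬ IsCyclic G) :
    ∃ x y : G, orderOf x = p ∧ orderOf y = p ∧ Commute x y ∧ y ∉ Subgroup.zpowers x := by
  obtain ⟨H, hH⟩ := exists_minimal_of_wellFoundedLT
    (fun H : Subgroup G => ¬ IsCyclic H)
    ⟨⊤, fun h => hc (Subgroup.topEquiv.isCyclic.1 h)⟩
  obtain ⟨x, y, hx, hy, hxy, hyx⟩ := (hG.to_subgroup H).exists_commute_of_forall_isCyclic hp2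
    hH.prop (by
      intro K hK
      by_contra hKc
      have hle : K.map H.subtype ≤ H := Subgroup.map_subtype_le K
      have h1 := hH.le_of_le (y := K.map H.subtype) (fun h => hKc
        ((K.equivMapOfInjective H.subtype H.subtype_injective).isCyclic.2 h)) hle
      refine hK (eq_top_iff.2 fun g _ => ?_)
      obtain ⟨k, hk, hkg⟩ := h1 g.2
      exact (H.subtype_injective hkg) ▸ hk)
  refine ⟨x, y, by simpa using hx, by simpa using hy, congrArg Subtype.val hxy, fun h => hyx ?_⟩
  obtain ⟨k, hk⟩ := h
  exact ⟨k, Subtype.ext hk⟩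

end PGroup

section PrimeKernel

variable {q r : ℕ} [Fact q.Prime]

theorem AddMonoidHom.apply_eq_apply_one_mul (f : ZMod q →+ ZMod q) (x : ZMod q) :
    f x = f 1 * x := by
  have h := map_nsmul f x.val 1
  rwa [nsmul_eq_mul, nsmul_eq_mul, mul_one, ZMod.natCast_zmod_val, mul_comm] at h

theorem exists_zmod_coordinates {N : Type*} [Group N] (hN : Nat.card N = q) :
    ∃ (e : N → ZMod q) (u : MulAut N →* (ZMod q)ˣ), Function.Injective e ∧ Function.Injective u ∧
      (∀ a b, e (a * b) = e a + e b) ∧ ∀ σ a, e (σ a) = u σ * e a := by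
  let E : N ≃* Multiplicative (ZMod q) := mulEquivOfPrimeCardEq (p := q) hN (by simp)
  let e : N → ZMod q := fun n => (E n).toAdd
  let c : MulAut N → ZMod q →+ ZMod q := fun σ =>
    (AddMonoidHom.toMultiplicative.symm
      ((E.toMonoidHom.comp σ.toMonoidHom).comp E.symm.toMonoidHom))
  have hc : ∀ σ a, e (σ a) = c σ (e a) := fun σ a => by
    change _ = (E (σ (E.symm (E a)))).toAdd
    rw [E.symm_apply_apply]
  have hcm : ∀ σ τ x, c (σ * τ) x = c σ (c τ x) := fun σ τ x => by
    change (E (σ (τ _))).toAdd = (E (σ (E.symm (E (τ _))))).toAdd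
    rw [E.symm_apply_apply]
  let u : MulAut N →* ZMod q :=
    { toFun := fun σ => c σ 1
      map_one' := by
        change (E (E.symm (Multiplicative.ofAdd 1))).toAdd = 1
        rw [E.apply_symm_apply]
        rfl
      map_mul' := fun σ τ => by rw [hcm, AddMonoidHom.apply_eq_apply_one_mul (c σ)] }
  have he : Function.Injective e := E.injective
  have hu : ∀ σ a, e (σ a) = MonoidHom.toHomUnits u σ * e a := fun σ a => by
    rw [hc, AddMonoidHom.apply_eq_apply_one_mul]
    rfl
  refine ⟨e, MonoidHom.toHomUnits u, he, ?_, fun a b => ?_, hu⟩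
  · refine (injective_iff_map_eq_one _).2 fun σ hσ => MulEquiv.ext fun a => he ?_
    rw [hu, hσ, Units.val_one, one_mul]
    rfl
  · change (E (a * b)).toAdd = _
    rw [map_mul]
    rfl

theorem exists_affineData {N K : Type*} [Group N] [Group K] (hN : Nat.card N = q)
    {j : K →* N ⋊[MonoidHom.id (MulAut N)] MulAut N} (hj : Function.Injective j)
    (hr : ∀ g, (j g).right ^ r = 1) : Nonempty (AffineData K q r) := by
  obtain ⟨e, u, he, hu1, hmul, hu⟩ := exists_zmod_coordinates hN
  have he1 : e 1 = 0 := by simpa using hmul 1 1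
  refine ⟨⟨u.comp (SemidirectProduct.rightHom.comp j), fun g => e (j g).left, fun g h => ?_,
    fun g h1 h2 => hj ?_, fun g => ?_⟩⟩
  · rw [map_mul, SemidirectProduct.mul_left, hmul]
    congr 1
    exact hu _ _
  · rw [map_one]
    refine SemidirectProduct.ext (he ?_) (hu1 ?_)
    · rw [h2, SemidirectProduct.one_left, he1]
    · rw [SemidirectProduct.one_right, map_one]
      exact h1
  · change u (j g).right ^ r = 1
    rw [← map_pow, hr, map_one]

theorem exists_eq_two_mul_mul_add_one [Fact r.Prime] {N : Type*} [Group N]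
    (hN : Nat.card N = q) (hq2 : q ≠ 2) (hr2 : r ≠ 2) {σ : MulAut N} (hσ : orderOf σ = r) :
    ∃ κ, 1 ≤ κ ∧ q = 2 * κ * r + 1 := by
  have hq := (Fact.out : q.Prime)
  obtain ⟨e, u, -, hu1, -, -⟩ := exists_zmod_coordinates hN
  have hdvd : r ∣ q - 1 := by
    rw [← hσ, ← orderOf_injective u hu1, ← ZMod.card_units q]
    exact orderOf_dvd_card
  have h2 : 2 ∣ q - 1 := (hq.even_sub_one hq2).two_dvd
  have hcop : Nat.Coprime 2 r :=
    ((Fact.out : r.Prime).odd_of_ne_two hr2).coprime_two_left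
  obtain ⟨k, hk⟩ := hcop.mul_dvd_of_dvd_of_dvd h2 hdvd
  have := hq.two_le
  refine ⟨k, Nat.pos_of_ne_zero ?_, ?_⟩
  · rintro rfl
    omega
  · rw [mul_right_comm, ← hk]
    omega

theorem atomBound_semidirectProduct [Fact r.Prime] {N L : Type*} [Group N] [Group L] [Finite L]
    [IsMulCommutative L] (hN : Nat.card N = q) (hq2 : q ≠ 2) (hr2 : r ≠ 2) (ψ : L →* MulAut N)
    (hψ : ∀ g, ψ g ^ r = 1) {g₀ : L} (hg : ψ g₀ ≠ 1) :
    ∃ k, r * k ≤ Nat.card L ∧ AtomBound (N ⋊[ψ] L) (k * (2 * q)) := by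
  have : Finite N := Nat.finite_of_card_ne_zero (hN ▸ (Fact.out : q.Prime).ne_zero)
  have : Finite (N ⋊[ψ] L) := Finite.of_equiv _ SemidirectProduct.equivProd.symm
  have hord : orderOf (ψ g₀) = r := orderOf_eq_prime (hψ g₀) hg
  obtain ⟨κ, hκ, hqκ⟩ := exists_eq_two_mul_mul_add_one hN hq2 hr2 hord
  let j : N ⋊[ψ] L →* N ⋊[MonoidHom.id (MulAut N)] MulAut N :=
    SemidirectProduct.map (MonoidHom.id N) ψ fun g => rfl
  obtain ⟨A⟩ := exists_affineData (K := j.range) (r := r) hN j.range.subtype_injective (by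
    rintro ⟨_, g, rfl⟩
    exact hψ _)
  have hr3 : 3 ≤ r := by
    have := (Fact.out : r.Prime).two_le
    omega
  have hker : ∀ g ∈ j.rangeRestrict.ker, j g = 1 := fun g hg => congrArg Subtype.val hg
  refine ⟨Nat.card j.rangeRestrict.ker, ?_, AtomBound.of_ker_inf_commutator j.rangeRestrict ?_
    (A.atomBound hκ hr3 hqκ)⟩
  · have hcard : Nat.card j.rangeRestrict.ker ≤ Nat.card ψ.ker := by
      refine Nat.card_le_card_of_injective (fun g => ⟨g.1.right, ?_⟩) ?_
      · exact congrArg SemidirectProduct.right (hker g g.2)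
      · intro g h hgh
        refine Subtype.ext (SemidirectProduct.ext ?_ (congrArg Subtype.val hgh))
        exact (congrArg SemidirectProduct.left (hker g g.2)).trans
          (congrArg SemidirectProduct.left (hker h h.2)).symm
    rw [← ψ.ker.card_mul_index, Subgroup.index_ker, mul_comm]
    refine Nat.mul_le_mul hcard ?_
    rw [← hord, ← Nat.card_zpowers]
    exact Subgroup.card_le_of_le (Subgroup.zpowers_le.2 ⟨g₀, rfl⟩)
  · rw [eq_bot_iff]
    rintro g ⟨hg1, hg2⟩
    have hle : commutator (N ⋊[ψ] L) ≤ SemidirectProduct.rightHom.ker := by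
      rw [commutator_def, Subgroup.commutator_le]
      intro a _ b _
      rw [MonoidHom.mem_ker, map_commutatorElement, commutatorElement_eq_one_iff_mul_comm]
      exact mul_comm' _ _
    have hl := congrArg SemidirectProduct.left (hker g hg1)
    exact Subgroup.mem_bot.2 (SemidirectProduct.ext hl (hle hg2))

end PrimeKernel

section Odd

variable {G : Type*} [Group G] [Finite G]

theorem atomBound_of_normalizerMonoidHom_ne_one {q r : ℕ} [Fact q.Prime] [Fact r.Prime]
    (hq2 : q ≠ 2) (hr2 : r ≠ 2) {N : Subgroup G} (hN : Nat.card N = q)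
    {x : Subgroup.normalizer (N : Set G)} (hx1 : N.normalizerMonoidHom x ≠ 1)
    (hxr : N.normalizerMonoidHom x ^ r = 1) :
    ∃ B, AtomBound G B ∧ r * B ≤ 2 * Nat.card G := by
  have hL : Subgroup.zpowers (x : G) ≤ Subgroup.normalizer (N : Set G) :=
    Subgroup.zpowers_le.2 x.2
  have hgen : ∀ g : Subgroup.zpowers (x : G), ∃ k : ℤ, Subgroup.inclusion hL g = x ^ k := by
    rintro ⟨_, k, rfl⟩
    exact ⟨k, rfl⟩
  obtain ⟨k, hk, hB⟩ := atomBound_semidirectProduct (L := Subgroup.zpowers (x : G)) hN hq2 hr2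
    (N.normalizerMonoidHom.comp (Subgroup.inclusion hL)) (fun g => by
      obtain ⟨k, hk⟩ := hgen g
      rw [MonoidHom.comp_apply, hk, map_zpow, ← zpow_natCast, ← zpow_mul, mul_comm, zpow_mul,
        zpow_natCast, hxr, one_zpow]) (g₀ := ⟨x, Subgroup.mem_zpowers _⟩) hx1
  let f := SemidirectProduct.monoidHomSubgroup hL
  have hdisj : Disjoint N (Subgroup.zpowers (x : G)) := by
    rw [Subgroup.disjoint_def]
    intro g hgN hgL
    by_contra hg1
    refine hx1 (MulEquiv.ext fun n => Subtype.ext ?_)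
    have hn : n ∈ Subgroup.zpowers (⟨g, hgN⟩ : N) := by
      rw [zpowers_eq_top_of_prime_card hN fun h => hg1 (congrArg Subtype.val h)]
      exact Subgroup.mem_top _
    obtain ⟨i, rfl⟩ := hn
    obtain ⟨j, rfl⟩ := hgL
    change (x : G) * ((x : G) ^ j) ^ i * (x : G)⁻¹ = ((x : G) ^ j) ^ i
    group
  have hf : Function.Injective f := by
    refine (injective_iff_map_eq_one f).2 fun a ha => ?_
    have ha' : (a.left : G) * a.right = 1 := ha
    have h1 : (a.left : G) = 1 := Subgroup.disjoint_def.1 hdisj a.left.2 (by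
      rw [eq_inv_of_mul_eq_one_left ha']
      exact inv_mem a.right.2)
    rw [h1, one_mul] at ha'
    exact SemidirectProduct.ext (Subtype.ext h1) (Subtype.ext ha')
  refine ⟨_, AtomBound.of_injective hf hB, ?_⟩
  have hc : Nat.card f.range = q * Nat.card (Subgroup.zpowers (x : G)) := by
    rw [← Nat.card_congr (MonoidHom.ofInjective hf).toEquiv, SemidirectProduct.card, hN]
  calc r * (k * (2 * q) * f.range.index) = r * k * (2 * q * f.range.index) := by ring
    _ ≤ Nat.card (Subgroup.zpowers (x : G)) * (2 * q * f.range.index) :=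
      Nat.mul_le_mul_right _ hk
    _ = 2 * (Nat.card f.range * f.range.index) := by rw [hc]; ring
    _ = _ := by rw [Subgroup.card_mul_index]

theorem atomBound_of_conj_mem_zpowers (hodd : Odd (Nat.card G)) {z h : G}
    (hz : (orderOf z).Prime) (hzh : h * z * h⁻¹ ∈ Subgroup.zpowers z) (hne : h * z * h⁻¹ ≠ z) :
    ∃ B, AtomBound G B ∧ (Nat.card G).minFac * B ≤ 2 * Nat.card G := by
  have := Fact.mk hz
  have hnorm : h ∈ Subgroup.normalizer (Subgroup.zpowers z : Set G) := by
    refine Subgroup.mem_normalizer_fintype ?_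
    rintro _ ⟨k, rfl⟩
    change h * z ^ k * h⁻¹ ∈ Subgroup.zpowers z
    rw [← conj_zpow]
    exact Subgroup.zpow_mem _ hzh k
  set φ := (Subgroup.zpowers z).normalizerMonoidHom
  have hφ : orderOf (φ ⟨h, hnorm⟩) ≠ 1 := by
    rw [Ne, orderOf_eq_one_iff]
    intro h1
    have h2 := DFunLike.congr_fun h1 (⟨z, Subgroup.mem_zpowers z⟩ : Subgroup.zpowers z)
    exact hne (congrArg Subtype.val h2)
  have hr := Nat.minFac_prime hφ
  have hrfact := Fact.mk hr
  have hord := orderOf_pow_orderOf_div (orderOf_pos (φ ⟨h, hnorm⟩)).ne'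
    (Nat.minFac_dvd (orderOf (φ ⟨h, hnorm⟩)))
  rw [← map_pow] at hord
  set r := (orderOf (φ ⟨h, hnorm⟩)).minFac
  have hrG : r ∣ Nat.card G := (Nat.minFac_dvd _).trans
    ((orderOf_map_dvd φ _).trans (Subgroup.orderOf_mk h hnorm ▸ orderOf_dvd_natCard h))
  have hne2 : ∀ m, m ∣ Nat.card G → m ≠ 2 := by
    rintro _ hm rfl
    exact Nat.not_even_iff_odd.2 hodd (even_iff_two_dvd.2 hm)
  obtain ⟨B, hB, hle⟩ := atomBound_of_normalizerMonoidHom_ne_one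
    (hne2 _ (orderOf_dvd_natCard z)) (hne2 r hrG) (Nat.card_zpowers z)
    (x := (⟨h, hnorm⟩ : Subgroup.normalizer (Subgroup.zpowers z : Set G)) ^
      (orderOf (φ ⟨h, hnorm⟩) / r))
    (fun h1 => hr.ne_one (by rw [← hord, orderOf_eq_one_iff]; exact h1))
    (by rw [← orderOf_dvd_iff_pow_eq_one]; exact hord.dvd)
  exact ⟨B, hB, (Nat.mul_le_mul_right _ (Nat.minFac_le_of_dvd hr.two_le hrG)).trans hle⟩

/-- A nontrivial automorphism of coprime order moves some element of prime order. -/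
theorem exists_prime_orderOf_apply_ne {N : Type*} [Group N] [Finite N] [IsMulCommutative N]
    {σ : MulAut N} {n : ℕ} (hσ : σ ^ n = 1) (hn : n.Coprime (Nat.card N)) (h1 : σ ≠ 1) :
    ∃ z, (orderOf z).Prime ∧ σ z ≠ z := by
  obtain ⟨y, hy, hmin⟩ : ∃ y, σ y ≠ y ∧ ∀ w, orderOf w < orderOf y → σ w = w := by
    obtain ⟨y, hy⟩ : ∃ y, σ y ≠ y := by
      by_contra! hall
      exact h1 (MulEquiv.ext hall)
    obtain ⟨y, hy, hmin⟩ := (measure (orderOf : N → ℕ)).wf.has_min {y | σ y ≠ y} ⟨y, hy⟩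
    exact ⟨y, hy, fun w hw => by_contra fun hne => hmin w hne hw⟩
  have hy1 : orderOf y ≠ 1 := by
    rw [Ne, orderOf_eq_one_iff]
    rintro rfl
    exact hy (map_one σ)
  obtain ⟨q, hq, hqy⟩ := Nat.exists_prime_and_dvd hy1
  have := Fact.mk hq
  set t := y⁻¹ * σ y with ht
  have ht1 : t ≠ 1 := fun h => hy (inv_mul_eq_one.1 h).symm
  have hyq : σ (y ^ q) = y ^ q := hmin _ (by
    rw [orderOf_pow_of_dvd hq.ne_zero hqy]
    exact Nat.div_lt_self (orderOf_pos y) hq.one_lt)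
  have htq : t ^ q = 1 := by
    rw [ht, (show Commute y⁻¹ (σ y) from mul_comm' _ _).mul_pow, ← map_pow, hyq, inv_pow,
      inv_mul_cancel]
  have hto : orderOf t = q := orderOf_eq_prime htq ht1
  refine ⟨t, hto ▸ hq, fun hfix => ?_⟩
  have hpow : ∀ k : ℕ, (σ ^ k) y = y * t ^ k := by
    intro k
    induction k with
    | zero => simp
    | succ k ih =>
      rw [pow_succ', MulAut.mul_apply, ih, map_mul, map_pow, hfix, pow_succ', ← mul_assoc, ht,
        mul_inv_cancel_left]
  have htn := hpow n
  rw [hσ, MulAut.one_apply, left_eq_mul] at htn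
  have h2 : q ∣ n := hto ▸ orderOf_dvd_of_pow_eq_one htn
  have h3 : q ∣ Nat.card N := hto ▸ orderOf_dvd_natCard t
  exact hq.not_dvd_one (hn ▸ Nat.dvd_gcd h2 h3)

theorem IsZGroup.exists_conj_mem_zpowers [IsZGroup G] (hc : ¬ IsCyclic G) :
    ∃ z h : G, (orderOf z).Prime ∧ h * z * h⁻¹ ∈ Subgroup.zpowers z ∧ h * z * h⁻¹ ≠ z := by
  obtain ⟨N, H, φ, e, hH, hN, hcop⟩ := isZGroup_iff_exists_mulEquiv.1 ‹IsZGroup G›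
  obtain ⟨h, hh⟩ : ∃ h, φ h ≠ 1 := by
    by_contra! hall
    obtain rfl : φ = 1 := MonoidHom.ext hall
    exact hc ((e.trans SemidirectProduct.mulEquivProd).isCyclic.2
      (Group.isCyclic_prod_iff.2 ⟨hN, hH, hcop⟩))
  obtain ⟨z, hz, hne⟩ := exists_prime_orderOf_apply_ne (n := Nat.card H) (σ := φ h)
    (by rw [← map_pow, pow_card_eq_one', map_one]) hcop.symm hh
  obtain ⟨m, hm⟩ := MonoidHom.map_cyclic (φ h).toMonoidHom
  have hconj : e.symm (SemidirectProduct.inr h) * e.symm (SemidirectProduct.inl z) *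
      (e.symm (SemidirectProduct.inr h))⁻¹ = e.symm (SemidirectProduct.inl (φ h z)) := by
    rw [SemidirectProduct.inl_aut, map_mul, map_mul, map_inv, map_inv]
  refine ⟨e.symm (SemidirectProduct.inl z), e.symm (SemidirectProduct.inr h), ?_, ?_, ?_⟩
  · rwa [MulEquiv.orderOf_eq, orderOf_injective _ SemidirectProduct.inl_injective]
  · rw [hconj]
    refine ⟨m, ?_⟩
    change e.symm (SemidirectProduct.inl z) ^ m = _
    rw [← map_zpow, ← map_zpow, ← hm z]
    rfl
  · rw [hconj]
    exact fun h' => hne (SemidirectProduct.inl_injective (e.symm.injective h'))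

theorem exists_atomBound (hc : ¬ IsCyclic G) :
    ∃ B, AtomBound G B ∧ (Nat.card G).minFac * B ≤ 2 * Nat.card G := by
  rcases Nat.even_or_odd (Nat.card G) with heven | hodd
  · refine ⟨_, atomBound_card G, ?_⟩
    rw [(Nat.minFac_eq_two_iff _).2 heven.two_dvd]
  by_cases hZ : IsZGroup G
  · obtain ⟨z, h, hz, hzh, hne⟩ := IsZGroup.exists_conj_mem_zpowers hc
    exact atomBound_of_conj_mem_zpowers hodd hz hzh hne
  · rw [isZGroup_iff] at hZ
    push Not at hZ
    obtain ⟨p, hp, P, hP⟩ := hZ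
    have := Fact.mk hp
    have hP1 : Nat.card P ≠ 1 := fun h => hP
      (have := (Nat.card_eq_one_iff_unique.1 h).1; inferInstance)
    have hpG : p ∣ Nat.card G := by
      obtain ⟨n, hn⟩ := IsPGroup.iff_card.1 P.isPGroup'
      have hn0 : n ≠ 0 := by
        rintro rfl
        exact hP1 hn
      exact (dvd_pow_self p hn0).trans (hn ▸ (P : Subgroup G).card_subgroup_dvd_card)
    have hp2 : p ≠ 2 := by
      rintro rfl
      exact Nat.not_even_iff_odd.2 hodd (even_iff_two_dvd.2 hpG)
    obtain ⟨x, y, hx, hy, hxy, hyx⟩ := P.isPGroup'.exists_commute_of_not_isCyclic hp2 hP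
    obtain ⟨B, hB, hle⟩ := atomBound_of_commute (G := G) (p := p) (x := x) (y := y)
      (by rwa [Subgroup.orderOf_coe]) (by rwa [Subgroup.orderOf_coe]) (congrArg Subtype.val hxy)
      (by
        rintro ⟨k, hk⟩
        exact hyx ⟨k, Subtype.ext hk⟩)
    exact ⟨B, hB, (Nat.mul_le_mul_right _ (Nat.minFac_le_of_dvd hp.two_le hpG)).trans hle⟩

end Odd

theorem stmt18 (G : Type*) [Group G] [Finite G] (hcyc : ¬ IsCyclic G)
    (p : ℕ) (hp : p = (Nat.card G).minFac) :
    p * largeDavenport G ≤ 2 * Nat.card G := by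
  obtain ⟨B, hB, hle⟩ := exists_atomBound hcyc
  rw [hp]
  exact (Nat.mul_le_mul_left _ (largeDavenport_le hB)).trans hle
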